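/- arXiv:2106.09205 — 3 statements merged into one kernel-verified Lean document; each statement's English description precedes it below -/
import Mathlib

section
/- For any Hermitian matrix A ∈ ℂ^{km×km}, the (k,m)-characteristic polynomial ψ_{k,m}[A](x) is a monic polynomial of degree m all of whose roots are real. -/
open Polynomial

/-- The `(k,m)`-characteristic polynomial, with `k`-partitions of `[m]` encoded as
functions `g : Fin m → Fin k`. -/
noncomputable def psiCharPoly (k m : ℕ)
    (A : Matrix (Fin k × Fin m) (Fin k × Fin m) ℂ) : Polynomial ℂ :=
  ((k : ℂ) ^ m)⁻¹ •
    ∑ g : Fin m → Fin k,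
      (A.submatrix (fun i : Fin m => (g i, i)) (fun i : Fin m => (g i, i))).charpoly

open Matrix Function in
/-- If `M` is Hermitian and `z` lies in the upper half plane coordinatewise, then
`diagonal z - M` is nonsingular. -/
theorem det_diagonal_sub_ne_zero {ι : Type*} [Fintype ι] [DecidableEq ι]
    (M : Matrix ι ι ℂ) (hM : M.IsHermitian) (z : ι → ℂ) (hz : ∀ i, 0 < (z i).im) :
    (diagonal z - M).det ≠ 0 := by
  intro h
  obtain ⟨v, hv, hMv⟩ := exists_mulVec_eq_zero_iff.mpr h
  rw [sub_mulVec, sub_eq_zero] at hMv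
  have hreal : (star v ⬝ᵥ M *ᵥ v).im = 0 := hM.im_star_dotProduct_mulVec_self v
  rw [← hMv] at hreal
  have hsum : (star v ⬝ᵥ diagonal z *ᵥ v).im = ∑ i, (z i).im * Complex.normSq (v i) := by
    simp only [dotProduct, mulVec_diagonal, Complex.im_sum, Pi.star_apply]
    refine Finset.sum_congr rfl fun i _ => ?_
    simp [Complex.normSq_apply]
    ring
  obtain ⟨i, hi⟩ := Function.ne_iff.mp hv
  have hpos : 0 < ∑ i, (z i).im * Complex.normSq (v i) :=
    Finset.sum_pos' (fun j _ => mul_nonneg (hz j).le (Complex.normSq_nonneg _))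
      ⟨i, Finset.mem_univ i, mul_pos (hz i) (Complex.normSq_pos.mpr hi)⟩
  linarith

open Matrix Function in
/-- The determinant of `diagonal z - M` is affine in `z a`; its slope is expressed through the
matrix obtained from `M` by clearing row and column `a`. -/
theorem mul_det_diagonal_update_sub {ι R : Type*} [Fintype ι] [DecidableEq ι] [CommRing R]
    (M : Matrix ι ι R) (z : ι → R) (a : ι) (w : R) :
    z a * (diagonal (update z a w) - M).det =
      z a * (diagonal (update z a 0) - M).det +
        w * (diagonal z - of fun i j => if i = a ∨ j = a then 0 else M i j).det := by
  set N : Matrix ι ι R := of fun i j => if i = a ∨ j = a then 0 else M i j with hN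
  set E : Matrix ι ι R := (diagonal z - M).updateRow a (Pi.single a 1) with hE
  have hw : diagonal (update z a w) - M =
      (diagonal z - M).updateRow a ((diagonal (update z a 0) - M) a + w • Pi.single a 1) := by
    ext i j
    rcases eq_or_ne i a with rfl | hi
    · rcases eq_or_ne j i with rfl | hj
      · simp [sub_eq_add_neg, add_comm]
      · simp [hj, diagonal_apply_ne' _ hj]
    · simp [hi, diagonal_apply]
  have h0 : (diagonal z - M).updateRow a ((diagonal (update z a 0) - M) a) =
      diagonal (update z a 0) - M := by
    ext i j
    rcases eq_or_ne i a with rfl | hi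
    · simp
    · simp [hi, diagonal_apply]
  have hz : diagonal z - N = (diagonal z - N).updateRow a (z a • Pi.single a 1) := by
    ext i j
    rcases eq_or_ne i a with rfl | hi
    · rcases eq_or_ne j i with rfl | hj
      · simp [hN]
      · simp [hN, hj, diagonal_apply_ne' _ hj]
    · simp [hi]
  have hdet : ((diagonal z - N).updateRow a (Pi.single a 1)).det = E.det := by
    refine det_eq_of_forall_row_eq_smul_add_const (fun i => if i = a then 0 else M i a) a
      (by simp) fun i j => ?_
    rcases eq_or_ne i a with rfl | hi
    · simp [hE]
    · rcases eq_or_ne j a with rfl | hj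
      · simp [hE, hN, hi]
      · simp [hE, hN, hi, hj]
  rw [hw, det_updateRow_add, det_updateRow_smul, h0, ← hE, hz, det_updateRow_smul, hdet]
  ring

/-- Summing over an independent value at `a` instead of the value of `g` at `a`. -/
theorem sum_sum_eq_card_mul_sum {ι κ R : Type*} [Fintype ι] [DecidableEq ι] [Fintype κ]
    [CommRing R] (a : ι) (G : (ι → κ) → κ → R)
    (hG : ∀ g x y, G (Function.update g a x) y = G g y) :
    ∑ j, ∑ g, G g j = Fintype.card κ * ∑ g, G g (g a) := by
  have hswap : ∑ p : κ × (ι → κ), G p.2 p.1 = ∑ p : κ × (ι → κ), G p.2 (p.2 a) := by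
    refine Finset.sum_nbij' (fun p => (p.2 a, Function.update p.2 a p.1))
      (fun p => (p.2 a, Function.update p.2 a p.1)) ?_ ?_ ?_ ?_ ?_ <;> simp [hG]
  rw [← Fintype.sum_prod_type' (f := fun j g => G g j), hswap, Fintype.sum_prod_type]
  simp

/-- A finite nonempty family of affine functions with common nonzero slope, none of which vanishes
on the upper half plane, has a sum not vanishing there either. -/
theorem sum_add_mul_ne_zero {κ : Type*} [Fintype κ] [Nonempty κ] (R : κ → ℂ) (D : ℂ) (hD : D ≠ 0)
    (h : ∀ j (w : ℂ), 0 < w.im → R j + w * D ≠ 0) (w : ℂ) (hw : 0 < w.im) :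
    ∑ j, (R j + w * D) ≠ 0 := by
  have him (j : κ) : 0 ≤ (R j / D).im := by
    by_contra! hneg
    refine h j (-(R j / D)) (by simpa using hneg) ?_
    field_simp
    ring
  have hfac : ∑ j, (R j + w * D) = (∑ j, (R j / D + w)) * D := by
    rw [Finset.sum_mul]
    refine Finset.sum_congr rfl fun j _ => ?_
    field_simp
  rw [hfac]
  refine mul_ne_zero (fun h0 => ?_) hD
  have hpos : 0 < (∑ j, (R j / D + w)).im := by
    rw [Complex.im_sum]
    refine Finset.sum_pos (fun j _ => ?_) Finset.univ_nonempty
    rw [Complex.add_im]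
    linarith [him j]
  simp [h0] at hpos

open Matrix Function in
/-- The sum over all choices `g`, free on `s` and frozen to `c` off `s`, of the determinants
`det (diagonal z - A(g))` does not vanish when `z` lies in the upper half plane coordinatewise. -/
theorem sum_det_diagonal_sub_piecewise_ne_zero {ι κ : Type*} [Fintype ι] [DecidableEq ι]
    [Fintype κ] [Nonempty κ] (s : Finset ι) (A : Matrix (κ × ι) (κ × ι) ℂ) (hA : A.IsHermitian)
    (c : ι → κ) (z : ι → ℂ) (hz : ∀ i, 0 < (z i).im) :
    ∑ g : ι → κ, (diagonal z - A.submatrix (fun i => (s.piecewise g c i, i))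
      (fun i => (s.piecewise g c i, i))).det ≠ 0 := by
  induction s using Finset.induction_on generalizing A c z with
  | empty =>
    simpa using det_diagonal_sub_ne_zero _ (hA.submatrix _) z hz
  | insert a s ha ih =>
    set F : (ι → ℂ) → (ι → κ) → κ → ℂ := fun y g j =>
      (diagonal y - A.submatrix (fun i => (s.piecewise g (update c a j) i, i))
        (fun i => (s.piecewise g (update c a j) i, i))).det with hF
    have hpw (g : ι → κ) :
        (insert a s).piecewise g c = s.piecewise g (update c a (g a)) := by
      ext i
      rcases eq_or_ne i a with rfl | hi
      · simp [ha]
      · by_cases his : i ∈ s <;> simp [hi, his]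
    have hupd (g : ι → κ) (x : κ) (d : ι → κ) :
        s.piecewise (update g a x) d = s.piecewise g d := by
      ext i
      rcases eq_or_ne i a with rfl | hi
      · simp [ha]
      · by_cases his : i ∈ s <;> simp [hi, his]
    have hsum := sum_sum_eq_card_mul_sum a (F z) (fun g x y => by simp only [hF, hupd])
    simp only [hpw]
    refine right_ne_zero_of_mul (a := (Fintype.card κ : ℂ)) ?_
    rw [← hsum]
    have hza : z a ≠ 0 := fun h => by simpa [h] using hz a
    set A₀ : Matrix (κ × ι) (κ × ι) ℂ :=
      of fun p q => if p.2 = a ∨ q.2 = a then 0 else A p q with hA₀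
    have hA₀h : A₀.IsHermitian := by
      ext p q
      have := hA.apply p q
      by_cases hp : p.2 = a <;> by_cases hq : q.2 = a <;> simp_all
    set D : ℂ := (∑ g : ι → κ, (diagonal z - A₀.submatrix (fun i => (s.piecewise g c i, i))
      (fun i => (s.piecewise g c i, i))).det) / z a with hD
    have hD0 : D ≠ 0 := div_ne_zero (ih A₀ hA₀h c z hz) hza
    have haff (j : κ) (w : ℂ) :
        ∑ g, F (update z a w) g j = ∑ g, F (update z a 0) g j + w * D := by
      have key (g : ι → κ) : z a * F (update z a w) g j = z a * F (update z a 0) g j +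
          w * (diagonal z - A₀.submatrix (fun i => (s.piecewise g c i, i))
            (fun i => (s.piecewise g c i, i))).det := by
        simp only [hF]
        rw [mul_det_diagonal_update_sub]
        congr 4
        ext i l
        by_cases hi : i = a
        · simp [hA₀, hi]
        by_cases hl : l = a
        · simp [hA₀, hl]
        simp [hA₀, hi, hl, Finset.piecewise]
      refine mul_left_cancel₀ hza ?_
      rw [Finset.mul_sum, Finset.sum_congr rfl fun g _ => key g, Finset.sum_add_distrib,
        ← Finset.mul_sum, ← Finset.mul_sum, hD]
      field_simp
    have hne (j : κ) (w : ℂ) (hw : 0 < w.im) : ∑ g, F (update z a 0) g j + w * D ≠ 0 := by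
      rw [← haff]
      refine ih A hA (update c a j) (update z a w) fun i => ?_
      rcases eq_or_ne i a with rfl | hi
      · simpa using hw
      · simpa [hi] using hz i
    have := sum_add_mul_ne_zero _ D hD0 hne (z a) (hz a)
    simpa only [← haff, update_eq_self] using this

/-- `∑_g det (w - A(g))` does not vanish for `w` in the upper half plane. -/
theorem sum_det_scalar_sub_ne_zero {ι κ : Type*} [Fintype ι] [DecidableEq ι] [Fintype κ]
    [Nonempty κ] (A : Matrix (κ × ι) (κ × ι) ℂ) (hA : A.IsHermitian) (w : ℂ) (hw : 0 < w.im) :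
    ∑ g : ι → κ, (Matrix.scalar ι w -
      A.submatrix (fun i => (g i, i)) (fun i => (g i, i))).det ≠ 0 := by
  simpa using sum_det_diagonal_sub_piecewise_ne_zero Finset.univ A hA
    (fun _ => Classical.arbitrary κ) (fun _ => w) (fun _ => hw)

/-- `ψ_{k,m}[A]` has degree at most `m`, and its coefficient of degree `m` is `1`. -/
theorem psiCharPoly_natDegree_le_and_coeff (k m : ℕ) (hk : 0 < k)
    (A : Matrix (Fin k × Fin m) (Fin k × Fin m) ℂ) :
    (psiCharPoly k m A).natDegree ≤ m ∧ (psiCharPoly k m A).coeff m = 1 := by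
  have hdeg (M : Matrix (Fin m) (Fin m) ℂ) : M.charpoly.natDegree = m := by
    simp
  have hcoeff (M : Matrix (Fin m) (Fin m) ℂ) : M.charpoly.coeff m = 1 := by
    simpa only [Monic, leadingCoeff, hdeg] using M.charpoly_monic
  constructor
  · exact (natDegree_smul_le _ _).trans
      (natDegree_sum_le_of_forall_le _ _ fun g _ => (hdeg _).le)
  · have : (k : ℂ) ≠ 0 := by exact_mod_cast hk.ne'
    simp [psiCharPoly, hcoeff, this]

/-- For a Hermitian matrix `A ∈ ℂ^{km×km}`, `ψ_{k,m}[A]` is monic of degree `m`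
with all roots real. -/
theorem psiCharPoly_monic_degree_realRooted (k m : ℕ) (hk : 0 < k) (hm : 0 < m)
    (A : Matrix (Fin k × Fin m) (Fin k × Fin m) ℂ) (hA : A.IsHermitian) :
    (psiCharPoly k m A).Monic ∧ (psiCharPoly k m A).natDegree = m ∧
      ∀ z : ℂ, (psiCharPoly k m A).eval z = 0 → z.im = 0 := by
  obtain ⟨hle, hcoeff⟩ := psiCharPoly_natDegree_le_and_coeff k m hk A
  refine ⟨monic_of_natDegree_le_of_coeff_eq_one m hle hcoeff,
    natDegree_eq_of_le_of_coeff_ne_zero hle (by simp [hcoeff]), fun z hz => ?_⟩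
  have : Nonempty (Fin k) := ⟨⟨0, hk⟩⟩
  have hkm : ((k : ℂ) ^ m)⁻¹ ≠ 0 := inv_ne_zero (pow_ne_zero _ (by exact_mod_cast hk.ne'))
  have hsum : ∑ g : Fin m → Fin k, (Matrix.scalar (Fin m) z -
      A.submatrix (fun i => (g i, i)) (fun i => (g i, i))).det = 0 := by
    rw [psiCharPoly, eval_smul, eval_finsetSum, smul_eq_mul] at hz
    simpa only [Matrix.eval_charpoly] using (mul_eq_zero.mp hz).resolve_left hkm
  rcases lt_trichotomy z.im 0 with hneg | h0 | hpos
  · refine absurd ?_ (sum_det_scalar_sub_ne_zero (-A) hA.neg (-z) (by simpa using hneg))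
    have hdet (g : Fin m → Fin k) : (Matrix.scalar (Fin m) (-z) -
        (-A).submatrix (fun i => (g i, i)) (fun i => (g i, i))).det =
        (-1) ^ m * (Matrix.scalar (Fin m) z -
          A.submatrix (fun i => (g i, i)) (fun i => (g i, i))).det := by
      have := Matrix.det_neg (Matrix.scalar (Fin m) z -
          A.submatrix (fun i => (g i, i)) (fun i => (g i, i)))
      rw [Fintype.card_fin] at this
      rw [← this, neg_sub', map_neg, Matrix.submatrix_neg]
      rfl
    rw [Finset.sum_congr rfl fun g _ => hdet g, ← Finset.mul_sum, hsum, mul_zero]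
  · exact h0
  · exact absurd hsum (sum_det_scalar_sub_ne_zero A hA z hpos)
end

section
/- For any Hermitian matrix A ∈ ℂ^{km×km} and any vector v ∈ ℂ^{km}, the largest root of ψ_{k,m}[A] is at most the largest root of ψ_{k,m}[A + v v*]. -/
open Polynomial

/-- The largest (real) root of a real-rooted polynomial over `ℂ`. -/
noncomputable def maxRoot (p : Polynomial ℂ) : ℝ :=
  sSup {x : ℝ | p.eval (x : ℂ) = 0}

open Filter Topology in
/-- If `q / p` has nonpositive imaginary part on the upper half-plane, where `q = p - r`, then `q`
is nonnegative at the largest root of `p`. -/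
theorem eval_nonpos_of_pencil_ne_zero {p r : ℝ[X]} (hp : p.Monic) (hr : r.Monic)
    (hdeg : p.degree = r.degree)
    (hstab : ∀ z y : ℂ, 0 < z.im → 0 < y.im →
      aeval z p + y * (aeval z p - aeval z r) ≠ 0)
    {a : ℝ} (ha : p.eval a = 0) (hroot : ∀ x, a < x → p.eval x ≠ 0) :
    r.eval a ≤ 0 := by
  set q := p - r with hq
  have hqdeg : q.degree < p.degree :=
    degree_sub_lt_left hdeg hp.ne_zero (by rw [hp.leadingCoeff, hr.leadingCoeff])
  have him : ∀ z : ℂ, 0 < z.im → (aeval z q / aeval z p).im ≤ 0 := by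
    intro z hz
    by_contra! h
    have hw : aeval z q / aeval z p ≠ 0 := fun h0 => by simp [h0] at h
    have hqz : aeval z q ≠ 0 := fun h0 => hw (by simp [h0])
    have hy : 0 < (-(aeval z q / aeval z p)⁻¹).im := by
      rw [Complex.neg_im, Complex.inv_im, neg_div, neg_neg]
      exact div_pos h (Complex.normSq_pos.2 hw)
    refine hstab z _ hz hy ?_
    rw [← map_sub, ← hq, inv_div]
    field_simp
    ring
  have hderiv : ∀ x, a < x → deriv (fun t => q.eval t / p.eval t) x ≤ 0 := by
    intro x hx
    have hpx := hroot x hx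
    have hpc : aeval (x : ℂ) p ≠ 0 := by
      rw [← Complex.coe_algebraMap, aeval_algebraMap_apply_eq_algebraMap_eval]
      simpa using hpx
    have hquot := (q.hasDerivAt x).div (p.hasDerivAt x) hpx
    refine hquot.deriv.le.trans ?_
    have hline : HasDerivAt (fun t : ℝ => (x : ℂ) + t * Complex.I) Complex.I 0 := by
      simpa using ((Complex.ofRealCLM.hasDerivAt (x := (0 : ℝ))).mul_const Complex.I).const_add
        (x : ℂ)
    have hc := ((q.hasDerivAt_aeval (x : ℂ)).div (p.hasDerivAt_aeval (x : ℂ)) hpc)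
    have hcomp := HasDerivAt.comp_of_eq (0 : ℝ) hc hline (by simp)
    have him' := Complex.imCLM.hasFDerivAt.comp_hasDerivAt (0 : ℝ) hcomp
    have hlim := him'.tendsto_slope_zero_right
    have hval : ∀ s : ℝ[X], aeval (x : ℂ) s = ((s.eval x : ℝ) : ℂ) := fun s => by
      rw [← Complex.coe_algebraMap, aeval_algebraMap_apply_eq_algebraMap_eval]
    have hre : Complex.imCLM (((aeval (x : ℂ)) (derivative q) * aeval (x : ℂ) p -
        aeval (x : ℂ) q * aeval (x : ℂ) (derivative p)) / aeval (x : ℂ) p ^ 2 * Complex.I) =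
        (eval x (derivative q) * eval x p - eval x q * eval x (derivative p)) / eval x p ^ 2 := by
      simp only [hval, ← Complex.ofReal_mul, ← Complex.ofReal_sub, ← Complex.ofReal_pow,
        ← Complex.ofReal_div, Complex.imCLM_apply, Complex.im_ofReal_mul, Complex.I_im, mul_one]
    rw [hre] at hlim
    refine le_of_tendsto hlim ?_
    filter_upwards [self_mem_nhdsWithin] with t ht
    have ht : 0 < t := ht
    have h0 : (aeval (x : ℂ) q / aeval (x : ℂ) p).im = 0 := by
      rw [hval, hval, ← Complex.ofReal_div, Complex.ofReal_im]
    have h1 := him (x + t * Complex.I) (by simpa using ht)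
    simp only [zero_add, Function.comp_apply, Pi.div_apply, Complex.imCLM_apply, smul_eq_mul,
      Complex.ofReal_zero, zero_mul, add_zero, h0, sub_zero]
    exact mul_nonpos_of_nonneg_of_nonpos (by positivity) h1
  have hdiff : DifferentiableOn ℝ (fun t => q.eval t / p.eval t) (Set.Ioi a) := fun x hx =>
    (q.differentiable.differentiableAt.div p.differentiable.differentiableAt
      (hroot x hx)).differentiableWithinAt
  have hanti : AntitoneOn (fun t => q.eval t / p.eval t) (Set.Ioi a) := by
    refine antitoneOn_of_deriv_nonpos (convex_Ioi a) hdiff.continuousOn ?_ ?_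
    · rwa [interior_Ioi]
    · rw [interior_Ioi]
      exact hderiv
  have hlim : Tendsto (fun t => q.eval t / p.eval t) atTop (𝓝 0) :=
    div_tendsto_atTop_zero_of_degree_lt q p hqdeg
  have hquot : ∀ x, a < x → 0 ≤ q.eval x / p.eval x := fun x hx =>
    le_of_tendsto hlim <| (eventually_ge_atTop x).mono fun t ht =>
      hanti hx (hx.trans_le ht : a < t) ht
  have hppos : ∀ x, a < x → 0 < p.eval x := by
    have hdegp : 0 < p.degree := by
      rw [← natDegree_pos_iff_degree_pos, hp.natDegree_pos]
      rintro rfl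
      simp at ha
    have htop := p.tendsto_atTop_of_leadingCoeff_nonneg hdegp (by simp [hp.leadingCoeff])
    intro x hx
    by_contra! h
    obtain ⟨b, hb, hbx⟩ := ((htop.eventually_gt_atTop 0).and (eventually_ge_atTop x)).exists
    obtain ⟨c, hc, hc0⟩ := intermediate_value_Icc hbx p.continuous.continuousOn ⟨h, hb.le⟩
    exact hroot c (hx.trans_le hc.1) hc0
  have hqa : 0 ≤ q.eval a := by
    have : Tendsto (fun t => q.eval t) (𝓝[>] a) (𝓝 (q.eval a)) :=
      (q.continuous.tendsto a).mono_left nhdsWithin_le_nhds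
    refine ge_of_tendsto this ?_
    filter_upwards [self_mem_nhdsWithin] with x hx
    have := mul_nonneg (hquot x hx) (hppos x hx).le
    rwa [div_mul_cancel₀ _ (hroot x hx)] at this
  rw [hq, eval_sub, ha] at hqa
  linarith

open Matrix

/-- Summation over all choices preserves nonvanishing on the upper half-plane for families that are
affine in each variable, with a leading coefficient (the value at `none`) independent of the choice
made in that coordinate. -/
theorem sum_choices_ne_zero {k : ℕ} [NeZero k] : ∀ (m : ℕ)
    (D : (Fin m → Fin k) → (Fin m → Option ℂ) → ℂ)
    (_ : ∀ g X, (∀ i, ∀ z ∈ X i, 0 < z.im) → D g X ≠ 0)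
    (_ : ∀ g X i z, D g (Function.update X i (some z)) =
      z * D g (Function.update X i none) + D g (Function.update X i (some 0)))
    (_ : ∀ g X i j, D (Function.update g i j) (Function.update X i none) =
      D g (Function.update X i none))
    (X : Fin m → Option ℂ) (_ : ∀ i, ∀ z ∈ X i, 0 < z.im),
    ∑ g, D g X ≠ 0
  | 0, D, hne, _, _, X, hX => by
    simpa using hne _ X hX
  | m + 1, D, hne, hlin, hind, X, hX => by
    have hsum : ∑ g, D g X = ∑ g : Fin m → Fin k, ∑ j : Fin k,
        D (Fin.cons j g) (Fin.cons (X 0) (Fin.tail X)) := by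
      rw [Finset.sum_comm, ← Fintype.sum_prod_type',
        ← (Fin.consEquiv fun _ : Fin (m + 1) => Fin k).sum_comp]
      simp [Fin.consEquiv]
    rw [hsum]
    refine sum_choices_ne_zero m
      (fun g Y => ∑ j : Fin k, D (Fin.cons j g) (Fin.cons (X 0) Y)) ?_ ?_ ?_ (Fin.tail X)
      fun i z hz => hX i.succ z hz
    · intro g Y hY
      have hcons : ∀ o : Option ℂ, (∀ z ∈ o, 0 < z.im) →
          ∀ i, ∀ z ∈ (Fin.cons o Y : Fin (m + 1) → Option ℂ) i, 0 < z.im := by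
        intro o ho i
        refine Fin.cases ?_ (fun i => ?_) i
        · simpa using ho
        · simpa using hY i
      set E := D (Fin.cons 0 g) (Fin.cons none Y) with hE
      have hE0 : E ≠ 0 := hne _ _ (hcons none (by simp))
      have hindE : ∀ j, D (Fin.cons j g) (Fin.cons none Y) = E := by
        intro j
        have := hind (Fin.cons 0 g) (Fin.cons none Y) 0 j
        rwa [Fin.update_cons_zero, Fin.update_cons_zero] at this
      have hk : (k : ℂ) ≠ 0 := Nat.cast_ne_zero.2 (NeZero.ne k)
      rcases hX0 : X 0 with _ | z
      · simp only [hindE, Finset.sum_const, Finset.card_univ, Fintype.card_fin, nsmul_eq_mul]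
        exact mul_ne_zero hk hE0
      · have hz : 0 < z.im := hX 0 z (by simp [hX0])
        set F : Fin k → ℂ := fun j => D (Fin.cons j g) (Fin.cons (some 0) Y) with hF
        have haff : ∀ j w, D (Fin.cons j g) (Fin.cons (some w) Y) = w * E + F j := by
          intro j w
          have := hlin (Fin.cons j g) (Fin.cons none Y) 0 w
          rwa [Fin.update_cons_zero, Fin.update_cons_zero, Fin.update_cons_zero, hindE] at this
        have hFim : ∀ j, 0 ≤ (F j / E).im := by
          intro j
          by_contra! h
          refine hne (Fin.cons j g) (Fin.cons (some (-(F j / E))) Y) (hcons _ ?_) ?_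
          · simpa using h
          · rw [haff]
            field_simp
            ring
        have hsumE : ∑ j, D (Fin.cons j g) (Fin.cons (some z) Y) = E * ∑ j, (z + F j / E) := by
          rw [Finset.mul_sum]
          refine Finset.sum_congr rfl fun j _ => ?_
          rw [haff]
          field_simp
        rw [hsumE]
        refine mul_ne_zero hE0 fun h0 => ?_
        have him : 0 < (∑ j, (z + F j / E)).im := by
          rw [Complex.im_sum]
          refine Finset.sum_pos (fun j _ => ?_) Finset.univ_nonempty
          rw [Complex.add_im]
          exact add_pos_of_pos_of_nonneg hz (hFim j)
        simp [h0] at him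
    · intro g Y i z
      simp only [Fin.cons_update, hlin _ _ i.succ z, Finset.sum_add_distrib, Finset.mul_sum]
    · intro g Y i j
      simp only [Fin.cons_update, hind]

/-- The matrix `diag(x) - B` for `B` the principal submatrix of `M` selected by `g`, in which
the rows with `X i = none` are replaced by standard basis vectors. -/
noncomputable def choiceMatrix {k m : ℕ} (M : Matrix (Fin k × Fin m) (Fin k × Fin m) ℂ)
    (g : Fin m → Fin k) (X : Fin m → Option ℂ) : Matrix (Fin m) (Fin m) ℂ :=
  of fun i => (X i).elim (Pi.single i 1) fun z => z • Pi.single i 1 - fun j => M (g i, i) (g j, j)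

theorem choiceMatrix_some {k m : ℕ} (M : Matrix (Fin k × Fin m) (Fin k × Fin m) ℂ)
    (g : Fin m → Fin k) (z : ℂ) :
    choiceMatrix M g (fun _ => some z) =
      scalar (Fin m) z - M.submatrix (fun i => (g i, i)) (fun i => (g i, i)) := by
  ext i j
  simp [choiceMatrix, diagonal_apply, Pi.single_apply, eq_comm]

theorem det_choiceMatrix_ne_zero {k m : ℕ} {M : Matrix (Fin k × Fin m) (Fin k × Fin m) ℂ}
    (g : Fin m → Fin k)
    (hM : ∀ u : Fin m → ℂ, (star u ⬝ᵥ
      M.submatrix (fun i => (g i, i)) (fun i => (g i, i)) *ᵥ u).im ≤ 0)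
    (X : Fin m → Option ℂ) (hX : ∀ i, ∀ z ∈ X i, 0 < z.im) :
    (choiceMatrix M g X).det ≠ 0 := by
  intro hdet
  obtain ⟨u, hu0, hu⟩ := exists_mulVec_eq_zero_iff.2 hdet
  have hnone : ∀ i, X i = none → u i = 0 := by
    intro i hi
    simpa [choiceMatrix, mulVec, hi] using congrFun hu i
  have hsome : ∀ i z, X i = some z →
      (M.submatrix (fun i => (g i, i)) (fun i => (g i, i)) *ᵥ u) i = z * u i := by
    intro i z hi
    have := congrFun hu i
    simp only [choiceMatrix, mulVec, hi, of_apply, Option.elim_some, sub_dotProduct,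
      smul_dotProduct, single_one_dotProduct, Pi.zero_apply, smul_eq_mul, sub_eq_zero] at this
    exact this.symm
  have hterm : ∀ i, (star u i *
      (M.submatrix (fun i => (g i, i)) (fun i => (g i, i)) *ᵥ u) i).im =
      (X i).elim 0 Complex.im * Complex.normSq (u i) := by
    intro i
    rcases hi : X i with _ | z
    · simp [hnone i hi]
    · rw [hsome i z hi, mul_left_comm, Pi.star_apply, Complex.star_def,
        ← Complex.normSq_eq_conj_mul_self, Complex.im_mul_ofReal]
      rfl
  have hnonneg : ∀ i, 0 ≤ (X i).elim 0 Complex.im * Complex.normSq (u i) := by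
    intro i
    refine mul_nonneg ?_ (Complex.normSq_nonneg _)
    rcases hi : X i with _ | z
    · exact le_rfl
    · exact (hX i z hi).le
  have hle := hM u
  simp only [dotProduct, Complex.im_sum] at hle
  rw [Finset.sum_congr rfl fun i _ => hterm i] at hle
  have hzero := (Finset.sum_eq_zero_iff_of_nonneg fun i _ => hnonneg i).1
    (le_antisymm hle (Finset.sum_nonneg fun i _ => hnonneg i))
  refine hu0 (funext fun i => ?_)
  rcases hi : X i with _ | z
  · exact hnone i hi
  · have := hzero i (Finset.mem_univ i)
    rw [hi] at this
    simpa [(hX i z hi).ne'] using this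

theorem choiceMatrix_update {k m : ℕ} (M : Matrix (Fin k × Fin m) (Fin k × Fin m) ℂ)
    (g : Fin m → Fin k) (X : Fin m → Option ℂ) (i : Fin m) (o : Option ℂ) :
    choiceMatrix M g (Function.update X i o) = (choiceMatrix M g X).updateRow i
      (o.elim (Pi.single i 1) fun z => z • Pi.single i 1 - fun j => M (g i, i) (g j, j)) := by
  ext a b
  by_cases h : a = i
  · subst h
    simp [choiceMatrix]
  · simp [choiceMatrix, h]

theorem det_updateRow_single_eq_det_updateCol_single {n R : Type*} [Fintype n] [DecidableEq n]
    [CommRing R] (N : Matrix n n R) (i : n) :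
    (N.updateRow i (Pi.single i 1)).det =
      ((N.updateRow i (Pi.single i 1)).updateCol i (Pi.single i 1)).det := by
  have h (B : Matrix n n R) :
      (B.updateRow i (Pi.single i 1)).det = (B.updateCol i (Pi.single i 1)).det := by
    rw [← adjugate_apply, ← det_transpose (B.updateCol _ _), ← updateRow_transpose,
      ← adjugate_apply, ← adjugate_transpose, transpose_apply]
  rw [← h, updateRow_idem]

theorem eval_psiCharPoly_ne_zero {k m : ℕ} (hk : 0 < k)
    {M : Matrix (Fin k × Fin m) (Fin k × Fin m) ℂ}
    (hM : ∀ (g : Fin m → Fin k) (u : Fin m → ℂ), (star u ⬝ᵥ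
      M.submatrix (fun i => (g i, i)) (fun i => (g i, i)) *ᵥ u).im ≤ 0)
    {z : ℂ} (hz : 0 < z.im) : (psiCharPoly k m M).eval z ≠ 0 := by
  have : NeZero k := ⟨hk.ne'⟩
  have key := sum_choices_ne_zero m (fun g X => (choiceMatrix M g X).det)
    (fun g X hX => det_choiceMatrix_ne_zero g (hM g) X hX)
    (fun g X i z => by
      simp only [choiceMatrix_update, Option.elim_some, Option.elim_none, sub_eq_add_neg,
        det_updateRow_add, det_updateRow_smul, zero_mul, zero_add])
    (fun g X i j => by
      simp only [choiceMatrix_update, Option.elim_none]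
      rw [det_updateRow_single_eq_det_updateCol_single,
        det_updateRow_single_eq_det_updateCol_single (choiceMatrix M g X)]
      congr 1
      ext a b
      by_cases hb : b = i
      · simp [hb]
      by_cases ha : a = i
      · simp [hb, ha]
      rcases hX : X a <;> simp [choiceMatrix, hb, ha, hX])
    (fun _ => some z) (by simp [hz])
  rw [psiCharPoly, eval_smul, eval_finsetSum]
  refine smul_ne_zero (inv_ne_zero (pow_ne_zero _ (Nat.cast_ne_zero.2 hk.ne'))) ?_
  convert key using 3 with g
  rw [eval_charpoly, choiceMatrix_some]

theorem exists_real_monic_psiCharPoly {k m : ℕ} (hk : 0 < k)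
    {A : Matrix (Fin k × Fin m) (Fin k × Fin m) ℂ} (hA : A.IsHermitian) :
    ∃ p : ℝ[X], p.Monic ∧ p.degree = m ∧ psiCharPoly k m A = p.map (algebraMap ℝ ℂ) := by
  have hk' : ((k : ℝ) ^ m) ≠ 0 := pow_ne_zero _ (Nat.cast_ne_zero.2 hk.ne')
  let P : (Fin m → Fin k) → ℝ[X] := fun g =>
    ∏ i, (X - C ((hA.submatrix fun i => (g i, i)).eigenvalues i))
  have hPm : ∀ g, (P g).Monic := fun g => monic_prod_of_monic _ _ fun i _ => monic_X_sub_C _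
  have hPd : ∀ g, (P g).natDegree = m := fun g => by
    rw [natDegree_prod_of_monic _ _ fun i _ => monic_X_sub_C _]
    simp
  set p : ℝ[X] := ((k : ℝ) ^ m)⁻¹ • ∑ g, P g with hp
  have hcoeff : p.coeff m = 1 := by
    have h1 : ∀ g, (P g).coeff m = 1 := fun g => by
      conv_lhs => rw [← hPd g]
      exact hPm g
    simp only [hp, coeff_smul, finsetSum_coeff, h1]
    simp [hk.ne']
  have hdeg : p.natDegree ≤ m :=
    (natDegree_smul_le _ _).trans (natDegree_sum_le_of_forall_le _ _ fun g _ => (hPd g).le)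
  have hmonic : p.Monic := monic_of_natDegree_le_of_coeff_eq_one m hdeg hcoeff
  refine ⟨p, hmonic, ?_, ?_⟩
  · refine le_antisymm (natDegree_le_iff_degree_le.1 hdeg) (le_degree_of_ne_zero ?_)
    simp [hcoeff]
  · have hsmul : p = C ((k : ℝ) ^ m)⁻¹ * ∑ g, P g := by rw [hp, smul_eq_C_mul]
    rw [hsmul, psiCharPoly, smul_eq_C_mul, Polynomial.map_mul, Polynomial.map_sum, map_C]
    congr 1
    · simp
    · refine Finset.sum_congr rfl fun g _ => ?_
      rw [(hA.submatrix fun i => (g i, i)).charpoly_eq, Polynomial.map_prod]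
      simp

theorem det_add_smul_vecMulVec {n R : Type*} [Fintype n] [DecidableEq n] [CommRing R]
    {B : Matrix n n R} (hB : IsUnit B.det) (y : R) (u w : n → R) :
    (B + y • vecMulVec u w).det = B.det + y * (B.det - (B - vecMulVec u w).det) := by
  have h : ∀ c : R, (B + c • vecMulVec u w).det = B.det * (1 + c * (w ⬝ᵥ B⁻¹ *ᵥ u)) := by
    intro c
    have := det_add_replicateCol_mul_replicateRow (ι := Unit) hB (c • u) w
    rw [← vecMulVec_eq, smul_vecMulVec, Matrix.mul_assoc, ← replicateCol_mulVec,
      mulVec_smul] at this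
    rw [this, det_unique (1 + _ : Matrix Unit Unit R), Matrix.add_apply,
      replicateRow_mul_replicateCol_apply]
    simp
  have h1 := h (-1)
  rw [neg_one_smul, ← sub_eq_add_neg] at h1
  rw [h, h1]
  ring

theorem im_star_dotProduct_sub_smul_vecMulVec_nonpos {n : Type*} [Fintype n]
    {A : Matrix n n ℂ} (hA : A.IsHermitian) {y : ℂ} (hy : 0 ≤ y.im) (v u : n → ℂ) :
    (star u ⬝ᵥ (A - y • vecMulVec v (star v)) *ᵥ u).im ≤ 0 := by
  have hAu : (star u ⬝ᵥ A *ᵥ u).im = 0 := hA.im_star_dotProduct_mulVec_self u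
  have hv : star u ⬝ᵥ (y • vecMulVec v (star v)) *ᵥ u = y * Complex.normSq (star v ⬝ᵥ u) := by
    rw [smul_mulVec, vecMulVec_mulVec, dotProduct_smul, dotProduct_smul,
      Complex.normSq_eq_conj_mul_self]
    simp only [MulOpposite.smul_eq_mul_unop, MulOpposite.unop_op, smul_eq_mul]
    rw [← Complex.star_def, ← star_dotProduct_star, star_star]
  rw [sub_mulVec, dotProduct_sub, Complex.sub_im, hAu, hv, Complex.im_mul_ofReal, zero_sub]
  exact neg_nonpos.2 (mul_nonneg hy (Complex.normSq_nonneg _))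

theorem eval_psiCharPoly_pencil_ne_zero {k m : ℕ} (hk : 0 < k)
    {A : Matrix (Fin k × Fin m) (Fin k × Fin m) ℂ} (hA : A.IsHermitian)
    (v : Fin k × Fin m → ℂ) {z y : ℂ} (hz : 0 < z.im) (hy : 0 ≤ y.im) :
    (psiCharPoly k m A).eval z + y * ((psiCharPoly k m A).eval z -
      (psiCharPoly k m (A + vecMulVec v (star v))).eval z) ≠ 0 := by
  have hsub (g : Fin m → Fin k) (c : ℂ) :
      (A - c • vecMulVec v (star v)).submatrix (fun i => (g i, i)) (fun i => (g i, i)) =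
        A.submatrix (fun i => (g i, i)) (fun i => (g i, i)) -
          c • vecMulVec (fun i => v (g i, i)) (star fun i => v (g i, i)) := rfl
  have hne : (psiCharPoly k m (A - y • vecMulVec v (star v))).eval z ≠ 0 :=
    eval_psiCharPoly_ne_zero hk (fun g u => by
      rw [hsub]
      exact im_star_dotProduct_sub_smul_vecMulVec_nonpos (hA.submatrix _) hy _ u) hz
  convert hne using 1
  simp only [psiCharPoly, eval_smul, eval_finsetSum, smul_eq_mul]
  rw [← mul_sub, mul_left_comm, ← mul_add, ← Finset.sum_sub_distrib, Finset.mul_sum,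
    ← Finset.sum_add_distrib]
  congr 1
  refine Finset.sum_congr rfl fun g _ => ?_
  simp only [eval_charpoly]
  have hunit : IsUnit (scalar (Fin m) z -
      A.submatrix (fun i => (g i, i)) (fun i => (g i, i))).det := by
    rw [← choiceMatrix_some, isUnit_iff_ne_zero]
    exact det_choiceMatrix_ne_zero g
      (fun u => ((hA.submatrix _).im_star_dotProduct_mulVec_self u).le) _ (by simp [hz])
  rw [hsub, ← sub_add, det_add_smul_vecMulVec hunit, sub_sub]
  rfl

/-- Adding a rank-one positive semidefinite matrix `v v*` can only increase the
largest root of the `(k,m)`-characteristic polynomial. -/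
theorem maxRoot_psiCharPoly_le_add_rankOne (k m : ℕ) (hk : 0 < k) (hm : 0 < m)
    (A : Matrix (Fin k × Fin m) (Fin k × Fin m) ℂ) (hA : A.IsHermitian)
    (v : Fin k × Fin m → ℂ) :
    maxRoot (psiCharPoly k m A)
      ≤ maxRoot (psiCharPoly k m (A + Matrix.vecMulVec v (star v))) := by
  have hA' : (A + vecMulVec v (star v)).IsHermitian := by
    refine hA.add ?_
    simp [IsHermitian, conjTranspose_vecMulVec]
  obtain ⟨p, hp, hpd, hpA⟩ := exists_real_monic_psiCharPoly hk hA
  obtain ⟨r, hr, hrd, hrA⟩ := exists_real_monic_psiCharPoly hk hA'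
  have hmax : ∀ s : ℝ[X], maxRoot (s.map (algebraMap ℝ ℂ)) = sSup {x : ℝ | s.IsRoot x} := by
    intro s
    simp only [maxRoot, ← Complex.coe_algebraMap, eval_map_algebraMap,
      aeval_algebraMap_apply_eq_algebraMap_eval, map_eq_zero_iff _ (algebraMap ℝ ℂ).injective]
    rfl
  have hfin : ∀ {s : ℝ[X]}, s.Monic → {x : ℝ | s.IsRoot x}.Finite := fun hs =>
    finite_setOfPred_isRoot hs.ne_zero
  have hpencil : ∀ z y : ℂ, 0 < z.im → 0 ≤ y.im →
      aeval z p + y * (aeval z p - aeval z r) ≠ 0 := by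
    intro z y hz hy
    have := eval_psiCharPoly_pencil_ne_zero hk hA v hz hy
    rwa [hpA, hrA, eval_map_algebraMap, eval_map_algebraMap] at this
  have hnonempty : {x : ℝ | p.IsRoot x}.Nonempty := by
    obtain ⟨z, hz⟩ := Complex.exists_root (f := p.map (algebraMap ℝ ℂ)) (by
      rw [degree_map, hpd]
      exact_mod_cast hm)
    rw [IsRoot, eval_map_algebraMap] at hz
    have hupper : ∀ w : ℂ, 0 < w.im → aeval w p ≠ 0 := fun w hw => by
      simpa using hpencil w 0 hw le_rfl
    have him : z.im = 0 := by
      rcases lt_trichotomy z.im 0 with h | h | h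
      · refine absurd ?_ (hupper (starRingEnd ℂ z) (by simpa using h))
        rw [aeval_conj, hz, map_zero]
      · exact h
      · exact absurd hz (hupper z h)
    refine ⟨z.re, ?_⟩
    have hzr : z = algebraMap ℝ ℂ z.re := Complex.ext (by simp) (by simp [him])
    rw [hzr, aeval_algebraMap_apply_eq_algebraMap_eval,
      map_eq_zero_iff _ (algebraMap ℝ ℂ).injective] at hz
    exact hz
  rw [hpA, hrA, hmax, hmax]
  set a := sSup {x : ℝ | p.IsRoot x} with ha
  have hap : p.IsRoot a := hnonempty.csSup_mem (hfin hp)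
  have hra : r.eval a ≤ 0 := eval_nonpos_of_pencil_ne_zero hp hr (hpd.trans hrd.symm)
    (fun z y hz hy => hpencil z y hz hy.le) hap fun x hx hx0 =>
      hx.not_ge (le_csSup (hfin hp).bddAbove hx0)
  have htop := r.tendsto_atTop_of_leadingCoeff_nonneg (by rw [hrd]; exact_mod_cast hm)
    (by simp [hr.leadingCoeff])
  obtain ⟨b, hb, hab⟩ :=
    ((htop.eventually_gt_atTop 0).and (Filter.eventually_ge_atTop a)).exists
  obtain ⟨c, hc, hc0⟩ := intermediate_value_Icc hab r.continuous.continuousOn ⟨hra, hb.le⟩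
  exact hc.1.trans (le_csSup (hfin hr).bddAbove hc0)
end

section
/- Let k ≥ 2, m ≥ 1 be integers and A ∈ ℂ^{km×km} a Hermitian matrix with 0 ⪯ A ⪯ I_{km}. Set ε := max_{1≤i≤m} Σ_{j=1}^k A(i+(j−1)m, i+(j−1)m). If ε ≤ (k−1)²/k, then the largest root of ψ_{k,m}[A] is at most (1/k)·(√(1 − ε/(k−1)) + √ε)². -/
open Polynomial
open scoped ComplexOrder

lemma pow_eq_one_of_forall_im_nonneg {r : ℂ} {n : ℕ} (hn : n ≠ 0) (hr : r ≠ 0)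
    (h : ∀ v : ℂ, 0 < v.im → 0 ≤ (r * v ^ n).im) : n = 1 ∧ r.im = 0 ∧ 0 ≤ r.re := by
  have hn1 : n = 1 := by
    by_contra hn1
    have hn2 : (2 : ℝ) ≤ n := by exact_mod_cast (show 2 ≤ n by omega)
    have key : ∀ a : ℝ, 0 < a → a < 8 →
        0 ≤ r.re * Real.sin (a * Real.pi / 4) + r.im * Real.cos (a * Real.pi / 4) := by
      intro a ha ha'
      have hv := h (Complex.exp ((a * Real.pi / (4 * n) : ℝ) * Complex.I)) (by
        rw [Complex.exp_ofReal_mul_I_im]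
        apply Real.sin_pos_of_pos_of_lt_pi
        · positivity
        · rw [div_lt_iff₀ (by positivity)]
          nlinarith [Real.pi_pos])
      rw [← Complex.exp_nat_mul, ← mul_assoc,
        show (n : ℂ) * ((a * Real.pi / (4 * n) : ℝ) : ℂ) = ((a * Real.pi / 4 : ℝ) : ℂ) by
          have : (n : ℂ) ≠ 0 := by exact_mod_cast hn
          push_cast
          field_simp, Complex.mul_im, Complex.exp_ofReal_mul_I_im,
        Complex.exp_ofReal_mul_I_re] at hv
      exact hv
    have h1 := key 1 (by norm_num) (by norm_num)
    have h3 := key 3 (by norm_num) (by norm_num)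
    have h5 := key 5 (by norm_num) (by norm_num)
    have h7 := key 7 (by norm_num) (by norm_num)
    rw [show 3 * Real.pi / 4 = Real.pi - 1 * Real.pi / 4 by ring, Real.sin_pi_sub,
      Real.cos_pi_sub] at h3
    rw [show 5 * Real.pi / 4 = 1 * Real.pi / 4 + Real.pi by ring, Real.sin_add_pi,
      Real.cos_add_pi] at h5
    rw [show 7 * Real.pi / 4 = 2 * Real.pi - 1 * Real.pi / 4 by ring, Real.sin_two_pi_sub,
      Real.cos_two_pi_sub] at h7
    rw [one_mul, Real.sin_pi_div_four, Real.cos_pi_div_four] at h1 h3 h5 h7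
    have hs : 0 < Real.sqrt 2 := by positivity
    apply hr
    apply Complex.ext
    · show r.re = 0
      nlinarith
    · show r.im = 0
      nlinarith
  subst hn1
  have key : ∀ M : ℝ, 0 ≤ r.re + M * r.im := by
    intro M
    have := h (M + Complex.I) (by simp)
    simp at this
    linarith
  have him : r.im = 0 := by
    by_contra hne
    have := key (-(r.re + 1) / r.im)
    rw [div_mul_cancel₀ _ hne] at this
    linarith
  exact ⟨rfl, him, by simpa using key 0⟩

lemma im_leadingCoeff_mul_pow_nonneg {N g : ℂ[X]} {l : ℝ} {n : ℕ} (hg : g.eval (l : ℂ) ≠ 0)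
    (h : ∀ z : ℂ, z.im < 0 → 0 ≤ (N.eval z / ((z - l) ^ n * g.eval z)).im)
    (v : ℂ) (hv : 0 < v.im) : 0 ≤ (N.eval (l : ℂ) / g.eval (l : ℂ) * v ^ n).im := by
  have hv0 : v ≠ 0 := by
    rintro rfl
    simp at hv
  have hcont : ContinuousAt
      (fun η : ℝ => (N.eval ((l : ℂ) + η * v⁻¹) / g.eval ((l : ℂ) + η * v⁻¹) * v ^ n).im) 0 := by
    have h1 : ContinuousAt (fun η : ℝ => N.eval ((l : ℂ) + η * v⁻¹)) 0 :=
      (N.continuous.comp (by fun_prop)).continuousAt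
    have h2 : ContinuousAt (fun η : ℝ => g.eval ((l : ℂ) + η * v⁻¹)) 0 :=
      (g.continuous.comp (by fun_prop)).continuousAt
    exact Complex.continuous_im.continuousAt.comp
      ((h1.div h2 (by simpa using hg)).mul continuousAt_const)
  have ht : Filter.Tendsto
      (fun η : ℝ => (N.eval ((l : ℂ) + η * v⁻¹) / g.eval ((l : ℂ) + η * v⁻¹) * v ^ n).im)
      (nhdsWithin 0 (Set.Ioi 0)) (nhds (N.eval (l : ℂ) / g.eval (l : ℂ) * v ^ n).im) := by
    have := hcont.tendsto
    simp only [Complex.ofReal_zero, zero_mul, add_zero] at this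
    exact this.mono_left nhdsWithin_le_nhds
  refine ge_of_tendsto ht ?_
  filter_upwards [self_mem_nhdsWithin] with η hη
  have hη : 0 < η := hη
  have hz := h ((l : ℂ) + η * v⁻¹) (by
    have : 0 < Complex.normSq v := Complex.normSq_pos.2 hv0
    simp only [Complex.add_im, Complex.ofReal_im, Complex.mul_im, Complex.ofReal_re, zero_mul,
      Complex.inv_im, add_zero, zero_add]
    rw [neg_div, mul_neg, neg_lt_zero]
    positivity)
  have heq : N.eval ((l : ℂ) + η * v⁻¹) / g.eval ((l : ℂ) + η * v⁻¹) * v ^ n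
      = ((η ^ n : ℝ) : ℂ) * (N.eval ((l : ℂ) + η * v⁻¹) /
        (((l : ℂ) + η * v⁻¹ - l) ^ n * g.eval ((l : ℂ) + η * v⁻¹))) := by
    have : (η : ℂ) ≠ 0 := by exact_mod_cast hη.ne'
    rw [add_sub_cancel_left, mul_pow, inv_pow]
    push_cast
    by_cases hg0 : g.eval ((l : ℂ) + η * v⁻¹) = 0
    · simp [hg0]
    · field_simp
  rw [heq, Complex.im_ofReal_mul]
  positivity

/-- Partial fractions of a rational function with real poles that maps the lower half plane to
the closed upper half plane. -/
lemma exists_partialFractions {κ : Type*} [DecidableEq κ] (l : κ → ℝ) (s : Finset κ) :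
    ∀ N : ℂ[X], N.natDegree ≤ s.card →
      (∀ z : ℂ, z.im < 0 → 0 ≤ (N.eval z / ∏ i ∈ s, (z - l i)).im) →
      ∃ (a : ℂ) (W : κ → ℝ), (∀ i, 0 ≤ W i) ∧
        N = C a * ∏ i ∈ s, (X - C (l i : ℂ)) +
          ∑ i ∈ s, C (W i : ℂ) * ∏ i' ∈ s.erase i, (X - C (l i' : ℂ)) := by
  induction s using Finset.strongInduction with
  | H s ih =>
  intro N hN hIm
  by_cases hroot : ∃ i ∈ s, N.eval (l i : ℂ) = 0
  · obtain ⟨i, hi, hNi⟩ := hroot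
    obtain ⟨N₁, rfl⟩ := dvd_iff_isRoot.2 (show N.IsRoot (l i : ℂ) from hNi)
    obtain ⟨a, W, hW, hN₁⟩ := ih (s.erase i) (Finset.erase_ssubset hi) N₁ (by
        rw [Finset.card_erase_of_mem hi]
        rcases eq_or_ne N₁ 0 with rfl | h0
        · simp
        · rw [natDegree_mul (X_sub_C_ne_zero _) h0, natDegree_X_sub_C] at hN
          omega) (by
        intro z hz
        have hne : z - l i ≠ 0 := by
          intro h
          have := congrArg Complex.im h
          simp at this
          exact hz.ne this
        have := hIm z hz
        rwa [← Finset.mul_prod_erase s _ hi, eval_mul, eval_sub, eval_X, eval_C,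
          mul_div_mul_left _ _ hne] at this)
    refine ⟨a, Function.update W i 0, ?_, ?_⟩
    · intro i'
      by_cases h : i' = i
      · subst h
        simp
      · simpa [h] using hW i'
    · rw [← Finset.mul_prod_erase s _ hi, ← Finset.add_sum_erase s _ hi]
      simp only [Function.update_self, Complex.ofReal_zero, map_zero, zero_mul, zero_add]
      conv_lhs => rw [hN₁]
      rw [mul_add, Finset.mul_sum]
      congr 1
      · ring
      · refine Finset.sum_congr rfl fun i' hi' => ?_
        have hne := Finset.ne_of_mem_erase hi'
        rw [Function.update_of_ne hne, ← Finset.mul_prod_erase (s.erase i') _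
          (Finset.mem_erase.2 ⟨hne.symm, hi⟩), Finset.erase_right_comm]
        ring
  · push Not at hroot
    have hpole : ∀ i ∈ s, (∀ i' ∈ s, l i' = l i → i' = i) ∧ ∃ W : ℝ, 0 ≤ W ∧
        N.eval (l i : ℂ) = W * ∏ i' ∈ s.erase i, ((l i : ℂ) - l i') := by
      intro i hi
      have hgi : (∏ i' ∈ s with ¬ l i' = l i, (X - C (l i' : ℂ))).eval (l i : ℂ) ≠ 0 := by
        rw [eval_prod, Finset.prod_ne_zero_iff]
        intro i' hi'
        rw [Finset.mem_filter] at hi'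
        rw [eval_sub, eval_X, eval_C, sub_ne_zero]
        exact_mod_cast Ne.symm hi'.2
      have hprod : ∀ z : ℂ, ∏ i' ∈ s, (z - l i') = (z - l i) ^ (s.filter (l · = l i)).card *
          (∏ i' ∈ s with ¬ l i' = l i, (X - C (l i' : ℂ))).eval z := by
        intro z
        rw [← Finset.prod_filter_mul_prod_filter_not s (l · = l i), eval_prod]
        congr 1
        · rw [← Finset.prod_const]
          refine Finset.prod_congr rfl fun i' hi' => ?_
          rw [(Finset.mem_filter.1 hi').2]
        · simp
      have himem : i ∈ s.filter (l · = l i) := by simp [hi]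
      obtain ⟨h1, h2, h3⟩ := pow_eq_one_of_forall_im_nonneg
        (Finset.card_ne_zero_of_mem himem) (div_ne_zero (hroot i hi) hgi)
        (im_leadingCoeff_mul_pow_nonneg hgi fun z hz => by
          rw [← hprod]
          exact hIm z hz)
      obtain ⟨i₀, hi₀⟩ := Finset.card_eq_one.1 h1
      have huniq : ∀ i' ∈ s, l i' = l i → i' = i := by
        intro i' hi' h
        have : i' ∈ s.filter (l · = l i) := by simp [hi', h]
        rw [hi₀, Finset.mem_singleton] at this himem
        rw [this, himem]
      refine ⟨huniq, _, h3, ?_⟩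
      rw [show s.erase i = s.filter (fun i' => ¬ l i' = l i) by
        ext i'
        simp only [Finset.mem_erase, Finset.mem_filter]
        constructor
        · rintro ⟨h, h'⟩
          exact ⟨h', fun h'' => h (huniq i' h' h'')⟩
        · rintro ⟨h, h'⟩
          exact ⟨fun h'' => h' (by rw [h'']), h⟩]
      set g := ∏ i' ∈ s with ¬ l i' = l i, (X - C (l i' : ℂ)) with hg
      have : ((N.eval (l i : ℂ) / g.eval (l i : ℂ)).re : ℂ)
          = N.eval (l i : ℂ) / g.eval (l i : ℂ) := by
        apply Complex.ext <;> simp [h2]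
      rw [this, show ∏ i' ∈ s with ¬ l i' = l i, ((l i : ℂ) - l i') = g.eval (l i : ℂ) by
        rw [hg, eval_prod]; simp]
      field_simp
    choose! hinj W hW hWN using hpole
    have hdegs : ∀ i ∈ s, (C (W i : ℂ) * ∏ i' ∈ s.erase i, (X - C (l i' : ℂ))).degree
        < s.card := by
      intro i hi
      refine lt_of_le_of_lt degree_le_natDegree ?_
      have h1 : (C (W i : ℂ) * ∏ i' ∈ s.erase i, (X - C (l i' : ℂ))).natDegree
          ≤ (s.erase i).card :=
        (natDegree_C_mul_le _ _).trans (natDegree_finsetProd_X_sub_C_eq_card _ _).le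
      rw [Finset.card_erase_of_mem hi] at h1
      have := Finset.card_pos.2 ⟨i, hi⟩
      exact_mod_cast (show _ < s.card by omega)
    refine ⟨N.coeff s.card, fun i => if i ∈ s then W i else 0, ?_, ?_⟩
    · intro i
      dsimp only
      split_ifs with h
      · exact hW i h
      · exact le_rfl
    · rw [Finset.sum_congr rfl (g := fun i => C (W i : ℂ) * ∏ i' ∈ s.erase i, (X - C (l i' : ℂ)))
        (fun i hi => by simp only [if_pos hi])]
      refine eq_of_degree_sub_lt_of_eval_index_eq (v := fun i => (l i : ℂ)) s ?_ ?_ ?_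
      · intro i hi i' hi' h
        exact hinj i' hi' i hi (Complex.ofReal_injective h)
      · rw [← sub_sub]
        refine lt_of_le_of_lt (degree_sub_le _ _) (max_lt ?_ ?_)
        · rw [degree_lt_iff_coeff_zero]
          intro d hd
          have hmon : (∏ i ∈ s, (X - C (l i : ℂ))).Monic := monic_prod_X_sub_C _ _
          have hnd : (∏ i ∈ s, (X - C (l i : ℂ))).natDegree = s.card :=
            natDegree_finsetProd_X_sub_C_eq_card _ _
          rw [coeff_sub, coeff_C_mul]
          rcases hd.eq_or_lt with rfl | hd
          · have : (∏ i ∈ s, (X - C (l i : ℂ))).coeff s.card = 1 := by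
              rw [← hnd]
              exact hmon
            rw [this, mul_one, sub_self]
          · rw [coeff_eq_zero_of_natDegree_lt (hN.trans_lt hd),
              coeff_eq_zero_of_natDegree_lt (hnd.trans_lt hd), mul_zero, sub_zero]
        · refine lt_of_le_of_lt (degree_sum_le _ _) ?_
          rw [Finset.sup_lt_iff (by simp)]
          exact hdegs
      · intro i hi
        rw [eval_add, eval_mul, eval_prod, Finset.prod_eq_zero hi (by simp), mul_zero, zero_add,
          eval_finsetSum, Finset.sum_eq_single_of_mem i hi, eval_mul, eval_C, eval_prod, hWN i hi]
        · simp
        · intro i' hi' hne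
          rw [eval_mul, eval_prod, Finset.prod_eq_zero (Finset.mem_erase.2 ⟨hne.symm, hi⟩)
            (by simp), mul_zero]

/-- The union of the open upper half plane and the real ray `(-∞, β]`. -/
def upperHalfRay (β : ℝ) : Set ℂ := {w | 0 < w.im ∨ (w.im = 0 ∧ w.re ≤ β)}

lemma ofReal_mem_upperHalfRay {β b : ℝ} : (b : ℂ) ∈ upperHalfRay β ↔ b ≤ β := by
  simp [upperHalfRay]

lemma zero_mem_upperHalfRay {β : ℝ} (hβ : 0 ≤ β) : (0 : ℂ) ∈ upperHalfRay β := by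
  simpa [upperHalfRay] using hβ

lemma exists_eq_prod_one_sub_mul_X (k : ℕ) (p : ℂ[X]) (hp : p.natDegree ≤ k)
    (h0 : p.eval 0 ≠ 0) :
    ∃ l : Fin k → ℂ, p = C (p.eval 0) * ∏ i, (1 - C (l i) * X) := by
  induction k generalizing p with
  | zero =>
    refine ⟨Fin.elim0, ?_⟩
    rw [eq_C_of_natDegree_le_zero hp]
    simp
  | succ k ih =>
    rcases Nat.eq_zero_or_pos p.natDegree with h | h
    · refine ⟨0, ?_⟩
      rw [eq_C_of_natDegree_le_zero h.le]
      simp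
    · obtain ⟨r, hr⟩ := Complex.exists_root (natDegree_pos_iff_degree_pos.1 h)
      obtain ⟨q, rfl⟩ := dvd_iff_isRoot.2 hr
      have hr0 : r ≠ 0 := by
        rintro rfl
        simp at h0
      have hq0 : q ≠ 0 := by
        rintro rfl
        simp at h0
      rw [natDegree_mul (X_sub_C_ne_zero _) hq0, natDegree_X_sub_C] at hp
      obtain ⟨l, hl⟩ := ih q (by omega) (by
        intro h
        simp [h] at h0)
      refine ⟨Fin.cons r⁻¹ l, ?_⟩
      rw [Fin.prod_univ_succ]
      simp only [Fin.cons_zero, Fin.cons_succ, eval_mul, eval_sub, eval_X, eval_C]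
      conv_lhs => rw [hl]
      have : (X - C r : ℂ[X]) = C (0 - r) * (1 - C r⁻¹ * X) := by
        rw [mul_sub, mul_one, ← mul_assoc, ← C_mul]
        simp [hr0]
        ring
      rw [this, C_mul]
      ring

lemma of_inv_notMem_upperHalfRay {β : ℝ} (hβ : 0 < β) {l : ℂ}
    (h : l ≠ 0 → l⁻¹ ∉ upperHalfRay β) :
    0 ≤ l.im ∧ (l.im = 0 → 0 ≤ l.re ∧ l.re * β < 1) := by
  rcases eq_or_ne l 0 with rfl | hl
  · simp
  have hn : 0 < Complex.normSq l := Complex.normSq_pos.2 hl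
  have h := h hl
  simp only [upperHalfRay, Set.mem_ofPred_eq, not_or, not_and, Complex.inv_im, Complex.inv_re,
    not_lt, not_le] at h
  obtain ⟨h1, h2⟩ := h
  have him : 0 ≤ l.im := by
    by_contra hneg
    push Not at hneg
    have : 0 < -l.im / Complex.normSq l := by
      apply div_pos <;> linarith
    linarith
  refine ⟨him, fun h0 => ?_⟩
  have h2 := h2 (by simp [h0])
  rw [lt_div_iff₀ hn] at h2
  have hre : 0 < l.re := by nlinarith
  refine ⟨hre.le, ?_⟩
  rw [Complex.normSq_apply, h0] at h2
  nlinarith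

lemma exists_factorization {β : ℝ} (hβ : 0 < β) {k : ℕ} {p : ℂ[X]} (hp : p.natDegree ≤ k)
    (hne : ∀ w ∈ upperHalfRay β, p.eval w ≠ 0) :
    ∃ l : Fin k → ℂ, p = C (p.eval 0) * ∏ i, (1 - C (l i) * X) ∧
      ∀ i, 0 ≤ (l i).im ∧ ((l i).im = 0 → 0 ≤ (l i).re ∧ (l i).re * β < 1) := by
  obtain ⟨l, hl⟩ := exists_eq_prod_one_sub_mul_X k p hp (hne 0 (zero_mem_upperHalfRay hβ.le))
  refine ⟨l, hl, fun i => of_inv_notMem_upperHalfRay hβ fun h0 hmem => hne _ hmem ?_⟩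
  rw [hl, eval_mul, eval_prod, Finset.prod_eq_zero (Finset.mem_univ i) (by simp [h0]), mul_zero]

lemma exists_real_factorization {β : ℝ} (hβ : 0 < β) {k : ℕ} {p : ℂ[X]} (hp : p.natDegree ≤ k)
    (hne : ∀ w ∈ upperHalfRay β, p.eval w ≠ 0)
    (hreal : ∀ w, p.eval (starRingEnd ℂ w) = starRingEnd ℂ (p.eval w)) :
    ∃ l : Fin k → ℝ, p = C (p.eval 0) * ∏ i, (1 - C (l i : ℂ) * X) ∧
      ∀ i, 0 ≤ l i ∧ l i * β < 1 := by
  obtain ⟨l, hl, hli⟩ := exists_factorization hβ hp hne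
  have him : ∀ i, (l i).im = 0 := by
    intro i
    refine le_antisymm ?_ (hli i).1
    have := (of_inv_notMem_upperHalfRay hβ (l := starRingEnd ℂ (l i))
      fun h0 hmem => hne _ hmem ?_).1
    · simpa using this
    · rw [← map_inv₀, hreal, hl, eval_mul, eval_prod,
        Finset.prod_eq_zero (Finset.mem_univ i), mul_zero, map_zero]
      have : l i ≠ 0 := by simpa using h0
      simp [this]
  refine ⟨fun i => (l i).re, ?_, fun i => (hli i).2 (him i)⟩
  have : ∀ i, ((l i).re : ℂ) = l i := fun i => Complex.ext (by simp) (by simp [him i])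
  simpa only [this] using hl

lemma eval_derivative_prod_one_sub_mul_X {κ : Type*} (s : Finset κ) (l : κ → ℂ) (b : ℂ)
    (hb : ∀ i ∈ s, 1 - l i * b ≠ 0) :
    (derivative (∏ i ∈ s, (1 - C (l i) * X))).eval b
      = -((∏ i ∈ s, (1 - C (l i) * X)).eval b * ∑ i ∈ s, l i / (1 - l i * b)) := by
  classical
  induction s using Finset.induction_on with
  | empty => simp
  | insert i s hi ih =>
    rw [Finset.prod_insert hi, Finset.sum_insert hi, derivative_mul, eval_add, eval_mul, eval_mul,
      ih fun i' hi' => hb i' (Finset.mem_insert_of_mem hi')]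
    have := hb i (Finset.mem_insert_self _ _)
    simp
    field_simp
    ring

/-- Integral-type representation of a rational function whose poles are real and which maps the
upper half plane to its closure. -/
lemma exists_nevanlinna_rep {k : ℕ} {p n : ℂ[X]} {c : ℂ} (hc : c ≠ 0) {l : Fin k → ℝ}
    (hp : p = C c * ∏ i, (1 - C (l i : ℂ) * X)) (hn : n.natDegree ≤ k)
    (hIm : ∀ w : ℂ, 0 < w.im → 0 ≤ (n.eval w / p.eval w).im) :
    ∃ (a : ℂ) (W : Fin k → ℝ), (∀ i, 0 ≤ W i) ∧
      (∀ w : ℂ, (∀ i, 1 - l i * w ≠ 0) →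
        n.eval w / p.eval w = a + ∑ i, (W i : ℂ) * (w / (1 - l i * w))) ∧
      (derivative n).eval 0 = a * (derivative p).eval 0 + (∑ i, (W i : ℂ)) * p.eval 0 := by
  set m : ℂ[X] := C c⁻¹ * n with hm
  have hmk : m.natDegree ≤ k := (natDegree_C_mul_le _ _).trans hn
  have hrefl : ∀ w : ℂ, w ≠ 0 → (reflect k m).eval w⁻¹ * w ^ k = m.eval w := by
    intro w hw
    let _ := invertibleOfNonzero hw
    have := eval₂_reflect_mul_pow (RingHom.id ℂ) w k m hmk
    simpa [eval₂_id] using this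
  have hprod : ∀ (s : Finset (Fin k)) (w : ℂ), w ≠ 0 →
      (∏ i ∈ s, (w⁻¹ - l i)) * w ^ s.card = ∏ i ∈ s, (1 - l i * w) := by
    intro s w hw
    rw [← Finset.prod_const, ← Finset.prod_mul_distrib]
    refine Finset.prod_congr rfl fun i _ => ?_
    field_simp
  obtain ⟨a, W, hW, hN⟩ := exists_partialFractions l Finset.univ (reflect k m)
    ((natDegree_reflect_le ..).trans (by simp [hmk])) (by
      intro z hz
      have hz0 : z ≠ 0 := by
        rintro rfl
        simp at hz
      have hw : 0 < (z⁻¹).im := by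
        rw [Complex.inv_im]
        exact div_pos (by linarith) (Complex.normSq_pos.2 hz0)
      have h1 := hrefl z⁻¹ (inv_ne_zero hz0)
      have h2 := hprod Finset.univ z⁻¹ (inv_ne_zero hz0)
      rw [inv_inv] at h1 h2
      have := hIm _ hw
      rw [hp, eval_mul, eval_C, eval_prod, ← div_div] at this
      have h3 : n.eval z⁻¹ / c = m.eval z⁻¹ := by
        rw [hm, eval_mul, eval_C]
        field_simp
      have h4 : ∏ i, (1 - C (l i : ℂ) * X : ℂ[X]).eval z⁻¹ = ∏ i, (1 - l i * z⁻¹) := by simp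
      rw [h3, ← h1, h4, ← h2, Finset.card_univ, Fintype.card_fin,
        mul_div_mul_right _ _ (pow_ne_zero _ (inv_ne_zero hz0))] at this
      exact this)
  have hmeq : m = C a * ∏ i, (1 - C (l i : ℂ) * X) +
      X * ∑ i, C (W i : ℂ) * ∏ i' ∈ Finset.univ.erase i, (1 - C (l i' : ℂ) * X) := by
    refine mul_left_cancel₀ (X_ne_zero (R := ℂ)) (Polynomial.funext fun w => ?_)
    rcases eq_or_ne w 0 with rfl | hw
    · simp
    rw [eval_mul (q := m), eval_mul (p := X), ← hrefl w hw, hN]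
    congr 1
    simp only [eval_add, eval_mul, eval_C, eval_prod, eval_sub, eval_X, eval_one, eval_finsetSum]
    rw [add_mul, mul_assoc, ← hprod Finset.univ w hw, Finset.card_univ, Fintype.card_fin,
      Finset.sum_mul, Finset.mul_sum]
    congr 1
    refine Finset.sum_congr rfl fun i _ => ?_
    rw [← hprod _ w hw, Finset.card_erase_of_mem (Finset.mem_univ i), Finset.card_univ,
      Fintype.card_fin]
    have hk : w ^ k = w * w ^ (k - 1) := by
      rw [← pow_succ', Nat.sub_add_cancel (Fin.pos i)]
    rw [hk]
    ring
  have hneq : n = C a * p + C c * (X *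
      ∑ i, C (W i : ℂ) * ∏ i' ∈ Finset.univ.erase i, (1 - C (l i' : ℂ) * X)) := by
    have : n = C c * m := by
      rw [hm, ← mul_assoc, ← C_mul, mul_inv_cancel₀ hc, C_1, one_mul]
    rw [this, hmeq, hp]
    ring
  refine ⟨a, W, hW, fun w hw => ?_, ?_⟩
  · have hpw : p.eval w ≠ 0 := by
      rw [hp, eval_mul, eval_C, eval_prod]
      refine mul_ne_zero hc (Finset.prod_ne_zero_iff.2 fun i _ => ?_)
      simpa using hw i
    rw [div_eq_iff hpw, add_mul, hneq, eval_add, eval_mul, eval_C]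
    congr 1
    rw [hp]
    simp only [eval_mul, eval_C, eval_prod, eval_sub, eval_X, eval_one, eval_finsetSum]
    rw [Finset.mul_sum, Finset.mul_sum, Finset.sum_mul]
    refine Finset.sum_congr rfl fun i _ => ?_
    rw [← Finset.mul_prod_erase _ _ (Finset.mem_univ i)]
    have := hw i
    generalize 1 - (l i : ℂ) * w = d at *
    field_simp
  · rw [hneq]
    have h1 : ∀ q : ℂ[X], (derivative (X * q)).eval 0 = q.eval 0 := by
      intro q
      simp
    rw [derivative_add, derivative_C_mul, derivative_C_mul, eval_add, eval_mul, eval_C, eval_mul,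
      eval_C, h1]
    congr 1
    rw [hp]
    simp [eval_finsetSum, eval_prod]
    ring

lemma le_sum_of_sum_inv_le {k : ℕ} (hk : 2 ≤ k) {e : Fin k → ℝ} {M y : ℝ}
    (he : ∀ i, 0 < e i) (he1 : ∀ i, e i ≤ 1) (hsum : ∑ i, (e i)⁻¹ ≤ k + M)
    (hy : k - ((k : ℝ) - 1) ^ 2 / (k - 1 + M) ≤ y) (i : Fin k) : e i ≤ y - k + ∑ i, e i := by
  have hk' : (2 : ℝ) ≤ k := by exact_mod_cast hk
  have hcs := Finset.sq_sum_div_le_sum_sq_div (Finset.univ.erase i) (fun _ => (1 : ℝ))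
    (g := fun i => (e i)⁻¹) (fun i _ => inv_pos.2 (he i))
  simp only [Finset.sum_const, Finset.card_erase_of_mem (Finset.mem_univ i), Finset.card_univ,
    Fintype.card_fin, nsmul_eq_mul, mul_one, one_pow, one_div, inv_inv] at hcs
  rw [Nat.cast_sub (by omega), Nat.cast_one] at hcs
  have h1 := Finset.add_sum_erase Finset.univ (fun i => (e i)⁻¹) (Finset.mem_univ i)
  have h2 := Finset.add_sum_erase Finset.univ e (Finset.mem_univ i)
  have h3 : 1 ≤ (e i)⁻¹ := (one_le_inv₀ (he i)).2 (he1 i)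
  have hpos : 0 < ∑ i ∈ Finset.univ.erase i, (e i)⁻¹ := by
    refine Finset.sum_pos (fun i _ => inv_pos.2 (he i)) (Finset.card_pos.1 ?_)
    rw [Finset.card_erase_of_mem (Finset.mem_univ i), Finset.card_univ, Fintype.card_fin]
    omega
  have h4 : ((k : ℝ) - 1) ^ 2 / (k - 1 + M) ≤
      ((k : ℝ) - 1) ^ 2 / ∑ i ∈ Finset.univ.erase i, (e i)⁻¹ := by
    apply div_le_div_of_nonneg_left (by positivity) hpos
    linarith
  linarith

namespace MvPolynomial

variable {ι : Type*} [DecidableEq ι]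

/-- The univariate polynomial obtained by fixing all variables except `i`. -/
noncomputable def slice (w : ι → ℂ) (i : ι) : MvPolynomial ι ℂ →ₐ[ℂ] ℂ[X] :=
  aeval (Function.update (fun l => Polynomial.C (w l)) i Polynomial.X)

/-- Substitution of `0` for the variable `i`. -/
noncomputable def restrictZero (i : ι) : MvPolynomial ι ℂ →ₐ[ℂ] MvPolynomial ι ℂ :=
  aeval (Function.update X i 0)

/-- The operator sending a polynomial with expansion `p₀ + p₁ zᵢ + ⋯` in the variable `zᵢ` to
`x p₀ + p₁ / k`. -/
noncomputable def shiftStep (x : ℝ) (k : ℕ) (i : ι) (P : MvPolynomial ι ℂ) : MvPolynomial ι ℂ :=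
  C (x : ℂ) * restrictZero i P + C ((k : ℂ)⁻¹) * restrictZero i (pderiv i P)

lemma shiftStep_C_mul (x : ℝ) (k : ℕ) (i : ι) (c : ℂ) (P : MvPolynomial ι ℂ) :
    shiftStep x k i (C c * P) = C c * shiftStep x k i P := by
  have hC : restrictZero i (C c) = C c := by simp [restrictZero]
  simp only [shiftStep, pderiv_mul, pderiv_C, zero_mul, zero_add, map_mul, hC]
  ring

lemma shiftStep_sum (x : ℝ) (k : ℕ) (i : ι) {κ : Type*} (s : Finset κ) (P : κ → MvPolynomial ι ℂ) :
    shiftStep x k i (∑ g ∈ s, P g) = ∑ g ∈ s, shiftStep x k i (P g) := by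
  simp only [shiftStep, map_sum, Finset.mul_sum, Finset.sum_add_distrib]

lemma eval_slice (w : ι → ℂ) (i : ι) (P : MvPolynomial ι ℂ) (u : ℂ) :
    (slice w i P).eval u = eval (Function.update w i u) P := by
  induction P using MvPolynomial.induction_on with
  | C a => simp [slice]
  | add p q hp hq => simp [hp, hq]
  | mul_X p l hp =>
    rw [map_mul, Polynomial.eval_mul, hp, map_mul]
    congr 1
    rcases eq_or_ne l i with rfl | h
    · simp [slice]
    · simp [slice, h]

lemma derivative_slice (w : ι → ℂ) (i : ι) (P : MvPolynomial ι ℂ) :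
    derivative (slice w i P) = slice w i (pderiv i P) := by
  induction P using MvPolynomial.induction_on with
  | C a => simp [slice]
  | add p q hp hq => simp [hp, hq]
  | mul_X p l hp =>
    have h : derivative (slice w i (X l)) = slice w i (pderiv i (X l)) := by
      rcases eq_or_ne l i with rfl | h
      · simp [slice]
      · simp [slice, h, pderiv_X_of_ne h]
    rw [map_mul, Polynomial.derivative_mul, hp, h, pderiv_mul, map_add, map_mul, map_mul]

lemma eval_restrictZero (w : ι → ℂ) (i : ι) (P : MvPolynomial ι ℂ) :
    eval w (restrictZero i P) = eval (Function.update w i 0) P := by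
  induction P using MvPolynomial.induction_on with
  | C a => simp [restrictZero]
  | add p q hp hq => simp [hp, hq]
  | mul_X p l hp =>
    rw [map_mul, map_mul, hp, map_mul]
    congr 1
    rcases eq_or_ne l i with rfl | h
    · simp [restrictZero]
    · simp [restrictZero, h]

lemma pderiv_restrictZero_self (i : ι) (P : MvPolynomial ι ℂ) :
    pderiv i (restrictZero i P) = 0 := by
  induction P using MvPolynomial.induction_on with
  | C a => simp [restrictZero]
  | add p q hp hq => simp [hp, hq]
  | mul_X p l hp =>
    rw [map_mul, pderiv_mul, hp, zero_mul, zero_add]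
    rcases eq_or_ne l i with rfl | h
    · simp [restrictZero]
    · simp [restrictZero, h, pderiv_X_of_ne h]

lemma pderiv_restrictZero_of_ne {i j : ι} (hij : i ≠ j) (P : MvPolynomial ι ℂ) :
    pderiv j (restrictZero i P) = restrictZero i (pderiv j P) := by
  induction P using MvPolynomial.induction_on with
  | C a => simp [restrictZero]
  | add p q hp hq => simp [hp, hq]
  | mul_X p l hp =>
    rw [map_mul, pderiv_mul, hp, pderiv_mul, map_add, map_mul, map_mul]
    congr 2
    rcases eq_or_ne l i with rfl | h
    · simp [restrictZero, pderiv_X_of_ne hij]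
    · rcases eq_or_ne l j with rfl | h'
      · simp [restrictZero, h]
      · simp [restrictZero, h, pderiv_X_of_ne h']

lemma pderiv_comm (i j : ι) (P : MvPolynomial ι ℂ) :
    pderiv i (pderiv j P) = pderiv j (pderiv i P) := by
  induction P using MvPolynomial.induction_on with
  | C a => simp
  | add p q hp hq => simp [hp, hq]
  | mul_X p l hp =>
    simp only [pderiv_mul, map_add, hp, pderiv_X]
    have : ∀ a b c : ι, pderiv a ((Pi.single b 1 : ι → MvPolynomial ι ℂ) c) = 0 := by
      intro a b c
      rcases eq_or_ne c b with rfl | h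
      · simp
      · simp [h]
    simp only [this]
    ring

lemma map_conj_restrictZero (i : ι) (P : MvPolynomial ι ℂ) :
    map (starRingEnd ℂ) (restrictZero i P) = restrictZero i (map (starRingEnd ℂ) P) := by
  induction P using MvPolynomial.induction_on with
  | C a => simp [restrictZero]
  | add p q hp hq => simp [hp, hq]
  | mul_X p l hp =>
    rw [map_mul, map_mul, hp, map_mul, map_mul]
    congr 1
    rcases eq_or_ne l i with rfl | h
    · simp [restrictZero]
    · simp [restrictZero, h]

lemma conj_eval {σ : Type*} (w : σ → ℂ) (P : MvPolynomial σ ℂ) :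
    starRingEnd ℂ (eval w P) = eval (fun l => starRingEnd ℂ (w l)) (map (starRingEnd ℂ) P) := by
  induction P using MvPolynomial.induction_on with
  | C a => simp
  | add p q hp hq => simp [hp, hq]
  | mul_X p l hp => simp [hp]

lemma restrictDegree_induction {σ : Type*} {k : ℕ} {motive : MvPolynomial σ ℂ → Prop}
    (h0 : motive 0) (hadd : ∀ P Q, motive P → motive Q → motive (P + Q))
    (hmon : ∀ (s : σ →₀ ℕ) (a : ℂ), (∀ i, s i ≤ k) → motive (monomial s a))
    {P : MvPolynomial σ ℂ} (hP : P ∈ restrictDegree σ ℂ k) : motive P := by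
  rw [mem_restrictDegree] at hP
  rw [P.as_sum]
  exact Finset.sum_induction _ motive hadd h0 fun s hs => hmon s _ (hP s hs)

lemma natDegree_slice_le {k : ℕ} {P : MvPolynomial ι ℂ} (hP : P ∈ restrictDegree ι ℂ k)
    (w : ι → ℂ) (i : ι) : (slice w i P).natDegree ≤ k := by
  refine restrictDegree_induction (motive := fun P => (slice w i P).natDegree ≤ k) (by simp)
    (fun P Q hP hQ => ?_) (fun s a hs => ?_) hP
  · rw [map_add]
    exact (natDegree_add_le _ _).trans (max_le hP hQ)
  · rw [slice, aeval_monomial]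
    refine (natDegree_C_mul_le _ _).trans ((natDegree_prod_le _ _).trans ?_)
    refine le_trans ?_ (hs i)
    have : ∀ l ∈ s.support, ((Function.update (fun l => Polynomial.C (w l)) i Polynomial.X) l
        ^ s l).natDegree ≤ if l = i then s l else 0 := by
      intro l _
      split_ifs with h
      · subst h
        simp
      · rw [Function.update_of_ne h, ← Polynomial.C_pow, natDegree_C]
    refine (Finset.sum_le_sum this).trans ?_
    rw [Finset.sum_ite_eq']
    split_ifs <;> simp

lemma monomial_mem_restrictDegree {σ : Type*} {k : ℕ} {s : σ →₀ ℕ} (hs : ∀ i, s i ≤ k) (a : ℂ) :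
    monomial s a ∈ restrictDegree σ ℂ k := by
  rw [mem_restrictDegree]
  intro t ht
  rw [Finset.mem_singleton.1 (support_monomial_subset ht)]
  exact hs

lemma pderiv_mem_restrictDegree {σ : Type*} {k : ℕ} {P : MvPolynomial σ ℂ}
    (hP : P ∈ restrictDegree σ ℂ k) (i : σ) : pderiv i P ∈ restrictDegree σ ℂ k := by
  refine restrictDegree_induction (motive := fun P => pderiv i P ∈ restrictDegree σ ℂ k) (by simp)
    (fun P Q hP hQ => ?_) (fun s a hs => ?_) hP
  · rw [map_add]
    exact add_mem hP hQ
  · rw [pderiv_monomial]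
    exact monomial_mem_restrictDegree (fun l => (Nat.sub_le _ _).trans (hs l)) _

lemma restrictZero_mem_restrictDegree {k : ℕ} {P : MvPolynomial ι ℂ}
    (hP : P ∈ restrictDegree ι ℂ k) (i : ι) : restrictZero i P ∈ restrictDegree ι ℂ k := by
  refine restrictDegree_induction (motive := fun P => restrictZero i P ∈ restrictDegree ι ℂ k)
    (by simp) (fun P Q hP hQ => ?_) (fun s a hs => ?_) hP
  · rw [map_add]
    exact add_mem hP hQ
  · by_cases hi : i ∈ s.support
    · rw [restrictZero, aeval_monomial, Finsupp.prod, Finset.prod_eq_zero hi, mul_zero]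
      · exact zero_mem _
      · simpa using hi
    · have : restrictZero i (monomial s a) = monomial s a := by
        rw [restrictZero, aeval_monomial, monomial_eq]
        congr 1
        refine Finsupp.prod_congr fun l hl => ?_
        rw [Function.update_of_ne]
        rintro rfl
        exact hi hl
      rw [this]
      exact monomial_mem_restrictDegree hs a

lemma shiftStep_mem_restrictDegree {k : ℕ} {P : MvPolynomial ι ℂ}
    (hP : P ∈ restrictDegree ι ℂ k) (x : ℝ) (n : ℕ) (i : ι) :
    shiftStep x n i P ∈ restrictDegree ι ℂ k := by
  rw [shiftStep, ← smul_eq_C_mul, ← smul_eq_C_mul]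
  exact add_mem (Submodule.smul_mem _ _ (restrictZero_mem_restrictDegree hP i))
    (Submodule.smul_mem _ _ (restrictZero_mem_restrictDegree (pderiv_mem_restrictDegree hP i) i))

lemma map_conj_shiftStep {P : MvPolynomial ι ℂ} (hP : map (starRingEnd ℂ) P = P) (x : ℝ) (n : ℕ)
    (i : ι) : map (starRingEnd ℂ) (shiftStep x n i P) = shiftStep x n i P := by
  rw [shiftStep, map_add, map_mul, map_mul, map_C, map_C, map_conj_restrictZero,
    map_conj_restrictZero, ← pderiv_map, hP]
  simp

end MvPolynomial

lemma eval_derivative_C_mul_prod {κ : Type*} [Fintype κ] {p : ℂ[X]} {c : ℂ} {l : κ → ℂ}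
    (hp : p = C c * ∏ i, (1 - C (l i) * X)) (b : ℂ) (hb : ∀ i, 1 - l i * b ≠ 0) :
    (derivative p).eval b = -(p.eval b * ∑ i, l i / (1 - l i * b)) := by
  have h := eval_derivative_prod_one_sub_mul_X Finset.univ l b fun i _ => hb i
  rw [hp, derivative_C_mul, eval_C_mul, h, eval_C_mul]
  ring

lemma eval_derivative_zero_C_mul_prod {κ : Type*} [Fintype κ] {p : ℂ[X]} {c : ℂ} {l : κ → ℂ}
    (hp : p = C c * ∏ i, (1 - C (l i) * X)) :
    (derivative p).eval 0 = -(p.eval 0 * ∑ i, l i) := by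
  simpa using eval_derivative_C_mul_prod hp 0 (by simp)

lemma one_sub_mul_le_mul_sum_sub {k : ℕ} (hk : 2 ≤ k) {β K x : ℝ} (hβ : 0 < β)
    {l : Fin k → ℝ} (hl : ∀ i, 0 ≤ l i ∧ l i * β < 1)
    (hK : ∑ i, l i / (1 - l i * β) ≤ K)
    (hx : k - ((k : ℝ) - 1) ^ 2 / (k - 1 + β * K) ≤ k * β * x) (i : Fin k) :
    1 - l i * β ≤ β * ∑ j, (x - l j) := by
  have hpos : ∀ i, 0 < 1 - l i * β := fun i => sub_pos.2 (hl i).2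
  have hsum : ∑ i, (1 - l i * β)⁻¹ ≤ k + β * K := by
    have : ∀ i, (1 - l i * β)⁻¹ = 1 + β * (l i / (1 - l i * β)) := by
      intro i
      have := (hpos i).ne'
      field_simp
      ring
    simp only [this, Finset.sum_add_distrib, ← Finset.mul_sum, Finset.sum_const,
      Finset.card_univ, Fintype.card_fin, nsmul_eq_mul, mul_one]
    gcongr
  have h := le_sum_of_sum_inv_le hk hpos
    (fun i => sub_le_self _ (mul_nonneg (hl i).1 hβ.le)) hsum hx i
  refine h.trans_eq ?_
  simp only [Finset.sum_sub_distrib, ← Finset.sum_mul, Finset.sum_const, Finset.card_univ,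
    Fintype.card_fin, nsmul_eq_mul]
  ring

lemma im_div_one_sub_mul_nonneg {β : ℝ} {r : ℂ}
    (hr : 0 ≤ r.im) : 0 ≤ (r / (1 - r * β)).im := by
  rw [Complex.div_im, ← sub_div]
  refine div_nonneg ?_ (Complex.normSq_nonneg _)
  simp
  ring_nf
  exact hr

lemma one_sub_mul_ofReal_ne_zero {β : ℝ} (hβ : 0 < β) {r : ℂ}
    (h : 0 ≤ r.im ∧ (r.im = 0 → 0 ≤ r.re ∧ r.re * β < 1)) : 1 - r * β ≠ 0 := by
  intro h0
  have him := congrArg Complex.im h0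
  have hre := congrArg Complex.re h0
  simp at him hre
  have := (h.2 (him.resolve_right hβ.ne')).2
  linarith

lemma div_one_sub_mul_le {l b β : ℝ} (hl : 0 ≤ l) (hlβ : l * β < 1) (hb : b ≤ β) :
    b / (1 - l * b) ≤ β / (1 - l * β) := by
  have : l * b ≤ l * β := mul_le_mul_of_nonneg_left hb hl
  rw [div_le_div_iff₀ (by linarith) (by linarith)]
  linarith

lemma re_div_le_of_im_div_nonneg {k : ℕ} {β b : ℝ} {p n : ℂ[X]} {c : ℂ} (hc : c ≠ 0)
    {l : Fin k → ℝ} (hl : ∀ i, 0 ≤ l i ∧ l i * β < 1)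
    (hp : p = C c * ∏ i, (1 - C (l i : ℂ) * X)) (hn : n.natDegree ≤ k)
    (hIm : ∀ w : ℂ, 0 < w.im → 0 ≤ (n.eval w / p.eval w).im) (hb : b ≤ β) :
    (n.eval (b : ℂ) / p.eval (b : ℂ)).re ≤ (n.eval (β : ℂ) / p.eval (β : ℂ)).re := by
  obtain ⟨a, W, hW, hrep, -⟩ := exists_nevanlinna_rep hc hp hn hIm
  have hne : ∀ u : ℝ, u ≤ β → ∀ i, 1 - (l i : ℂ) * u ≠ 0 := by
    intro u hu i h
    have := mul_le_mul_of_nonneg_left hu (hl i).1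
    have h' : 1 - l i * u = 0 := by exact_mod_cast h
    linarith [(hl i).2]
  have hre : ∀ u : ℝ, u ≤ β →
      (n.eval (u : ℂ) / p.eval (u : ℂ)).re = a.re + ∑ i, W i * (u / (1 - l i * u)) := by
    intro u hu
    rw [hrep u (hne u hu), Complex.add_re]
    congr 1
    exact_mod_cast Complex.ofReal_re (∑ i, W i * (u / (1 - l i * u)))
  rw [hre b hb, hre β le_rfl]
  exact add_le_add_right (Finset.sum_le_sum fun i _ => mul_le_mul_of_nonneg_left
    (div_one_sub_mul_le (hl i).1 (hl i).2 hb) (hW i)) _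

lemma eq_zero_of_im_div_nonpos {n p : ℂ[X]} (hp : ∀ w : ℂ, 0 < w.im → p.eval w ≠ 0)
    (h : ∀ w : ℂ, 0 < w.im → (n.eval w / p.eval w).im ≤ 0) {z : ℂ} (hz : 0 < z.im)
    (hnz : n.eval z = 0) : n = 0 := by
  have hnhds : {w : ℂ | 0 < w.im} ∈ nhds z :=
    (isOpen_lt continuous_const Complex.continuous_im).mem_nhds hz
  have hg : AnalyticAt ℂ (fun w => n.eval w / p.eval w) z :=
    AnalyticAt.div (AnalyticAt.aeval_polynomial analyticAt_id n)
      (AnalyticAt.aeval_polynomial analyticAt_id p) (hp z hz)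
  rcases hg.eventually_constant_or_nhds_le_map_nhds with hconst | hopen
  · refine eq_zero_of_infinite_isRoot n ((infinite_of_mem_nhds z
      (Filter.inter_mem hnhds hconst)).mono ?_)
    rintro w ⟨hw, hw'⟩
    simp only [Set.mem_ofPred_eq, hnz, zero_div] at hw'
    exact (div_eq_zero_iff.1 hw').resolve_right (hp w hw)
  · exfalso
    have h1 : {w : ℂ | w.im ≤ 0} ∈ nhds (0 : ℂ) := by
      have h2 := hopen (Filter.image_mem_map hnhds)
      simp only [hnz, zero_div] at h2
      refine Filter.mem_of_superset h2 ?_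
      rintro _ ⟨w, hw, rfl⟩
      exact h w hw
    obtain ⟨δ, hδ, hball⟩ := Metric.mem_nhds_iff.1 h1
    have : ((δ / 2 : ℝ) : ℂ) * Complex.I ∈ Metric.ball (0 : ℂ) δ := by
      simp [abs_of_pos hδ, hδ]
    have := hball this
    simp at this
    linarith

namespace MvPolynomial

variable {ι : Type*} [DecidableEq ι]

lemma update_mem_upperHalfRay {β : ℝ} {w : ι → ℂ} {i : ι} {u : ℂ}
    (hw : ∀ l, l ≠ i → w l ∈ upperHalfRay β) (hu : u ∈ upperHalfRay β) (j : ι) :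
    Function.update w i u j ∈ upperHalfRay β := by
  rcases eq_or_ne j i with rfl | h
  · simpa using hu
  · simpa [h] using hw j h

lemma exists_slice_factorization {k : ℕ} {β : ℝ} (hβ : 0 < β) {P : MvPolynomial ι ℂ}
    (hP : P ∈ restrictDegree ι ℂ k) (hne : ∀ w, (∀ i, w i ∈ upperHalfRay β) → eval w P ≠ 0)
    {w : ι → ℂ} {i : ι} (hw : ∀ l, l ≠ i → w l ∈ upperHalfRay β) :
    ∃ l : Fin k → ℂ, slice w i P = Polynomial.C ((slice w i P).eval 0) *
        ∏ j, (1 - Polynomial.C (l j) * Polynomial.X) ∧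
      ∀ j, 0 ≤ (l j).im ∧ ((l j).im = 0 → 0 ≤ (l j).re ∧ (l j).re * β < 1) := by
  refine exists_factorization hβ (natDegree_slice_le hP w i) fun u hu => ?_
  rw [eval_slice]
  exact hne _ (update_mem_upperHalfRay hw hu)

lemma exists_real_slice_factorization {k : ℕ} {β : ℝ} (hβ : 0 < β) {P : MvPolynomial ι ℂ}
    (hP : P ∈ restrictDegree ι ℂ k) (hconj : map (starRingEnd ℂ) P = P)
    (hne : ∀ w, (∀ i, w i ∈ upperHalfRay β) → eval w P ≠ 0)
    {w : ι → ℝ} (hw : ∀ l, w l ≤ β) (i : ι) :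
    ∃ l : Fin k → ℝ, slice (fun j => (w j : ℂ)) i P =
        Polynomial.C ((slice (fun j => (w j : ℂ)) i P).eval 0) *
          ∏ j, (1 - Polynomial.C (l j : ℂ) * Polynomial.X) ∧
      ∀ j, 0 ≤ l j ∧ l j * β < 1 := by
  refine exists_real_factorization hβ (natDegree_slice_le hP _ i) (fun u hu => ?_) fun u => ?_
  · rw [eval_slice]
    exact hne _ (update_mem_upperHalfRay (fun l _ => ofReal_mem_upperHalfRay.2 (hw l)) hu)
  · rw [eval_slice, eval_slice, conj_eval, hconj]
    congr 2
    ext l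
    rcases eq_or_ne l i with rfl | h
    · simp
    · simp [h]

lemma re_eval_div_le {k : ℕ} {β : ℝ} (hβ : 0 < β) {N Q : MvPolynomial ι ℂ} [Fintype ι]
    (hN : N ∈ restrictDegree ι ℂ k) (hQ : Q ∈ restrictDegree ι ℂ k)
    (hconj : map (starRingEnd ℂ) Q = Q)
    (hne : ∀ w, (∀ i, w i ∈ upperHalfRay β) → eval w Q ≠ 0)
    (hIm : ∀ w, (∀ i, w i ∈ upperHalfRay β) → 0 ≤ (eval w N / eval w Q).im)
    {b : ι → ℝ} (hb : ∀ i, b i ≤ β) :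
    (eval (fun i => (b i : ℂ)) N / eval (fun i => (b i : ℂ)) Q).re ≤
      (eval (fun _ => (β : ℂ)) N / eval (fun _ => (β : ℂ)) Q).re := by
  suffices h : ∀ s : Finset ι,
      (eval (fun i => (b i : ℂ)) N / eval (fun i => (b i : ℂ)) Q).re ≤
      (eval (fun i => ((if i ∈ s then β else b i : ℝ) : ℂ)) N /
        eval (fun i => ((if i ∈ s then β else b i : ℝ) : ℂ)) Q).re by
    simpa using h Finset.univ
  intro s
  induction s using Finset.induction_on with
  | empty => simp
  | insert i s hi ih =>
    refine ih.trans ?_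
    set c : ι → ℝ := fun l => if l ∈ s then β else b l
    have hc : ∀ l, c l ≤ β := fun l => by
      simp only [c]
      split_ifs
      exacts [le_rfl, hb l]
    have h1 : (fun l => (c l : ℂ)) = Function.update (fun l => (c l : ℂ)) i (b i : ℂ) := by
      rw [eq_comm, Function.update_eq_self_iff]
      simp [c, hi]
    have h2 : (fun l => ((if l ∈ insert i s then β else b l : ℝ) : ℂ)) =
        Function.update (fun l => (c l : ℂ)) i (β : ℂ) := by
      ext l
      rcases eq_or_ne l i with rfl | h
      · simp
      · simp [h, c]
    change (eval (fun l => (c l : ℂ)) N / eval (fun l => (c l : ℂ)) Q).re ≤ _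
    rw [h2]
    conv_lhs => rw [h1]
    obtain ⟨l, hl, hl'⟩ := exists_real_slice_factorization hβ hQ hconj hne hc i
    have hcD : ∀ l, l ≠ i → (c l : ℂ) ∈ upperHalfRay β :=
      fun l _ => ofReal_mem_upperHalfRay.2 (hc l)
    simp only [← eval_slice]
    refine re_div_le_of_im_div_nonneg ?_ hl' hl (natDegree_slice_le hN _ i) (fun w hw => ?_)
      (hb i)
    · rw [eval_slice]
      exact hne _ (update_mem_upperHalfRay hcD (zero_mem_upperHalfRay hβ.le))
    · rw [eval_slice, eval_slice]
      exact hIm _ (update_mem_upperHalfRay hcD (Or.inl hw))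

lemma eval_ne_zero_of_im_div_nonpos {β : ℝ} {N Q : MvPolynomial ι ℂ} [Fintype ι]
    (hne : ∀ w, (∀ i, w i ∈ upperHalfRay β) → eval w Q ≠ 0)
    (hIm : ∀ w, (∀ i, w i ∈ upperHalfRay β) → (eval w N / eval w Q).im ≤ 0)
    (hreal : ∀ b : ι → ℝ, (∀ i, b i ≤ β) → eval (fun i => (b i : ℂ)) N ≠ 0)
    (w : ι → ℂ) (hw : ∀ i, w i ∈ upperHalfRay β) : eval w N ≠ 0 := by
  suffices h : ∀ (s : Finset ι) (w : ι → ℂ), (∀ i, w i ∈ upperHalfRay β) →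
      (∀ i ∉ s, (w i).im = 0) → eval w N ≠ 0 from h Finset.univ w hw (by simp)
  intro s
  induction s using Finset.induction_on with
  | empty =>
    intro w hw h0
    have h : w = fun i => ((w i).re : ℂ) := by
      ext i
      exact (Complex.ext (by simp) (by simp [h0 i (Finset.notMem_empty i)]))
    rw [h]
    exact hreal _ fun i => ofReal_mem_upperHalfRay.1 (by rw [← congrFun h i]; exact hw i)
  | insert i s hi ih =>
    intro w hw h0 hzero
    have hz : 0 < (w i).im := by
      rcases hw i with h | h
      · exact h
      · refine (ih w hw (fun l hl => ?_) hzero).elim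
        rcases eq_or_ne l i with rfl | hli
        · exact h.1
        · exact h0 l (by simp [hl, hli])
    have hup : ∀ u : ℂ, u ∈ upperHalfRay β → ∀ l, Function.update w i u l ∈ upperHalfRay β :=
      fun u hu => update_mem_upperHalfRay (fun l _ => hw l) hu
    have hβ : (β : ℂ) ∈ upperHalfRay β := ofReal_mem_upperHalfRay.2 le_rfl
    have hn : slice w i N = 0 := by
      refine eq_zero_of_im_div_nonpos (p := slice w i Q) (fun u hu => ?_) (fun u hu => ?_) hz ?_
      · rw [eval_slice]
        exact hne _ (hup u (Or.inl hu))
      · rw [eval_slice, eval_slice]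
        exact hIm _ (hup u (Or.inl hu))
      · rw [eval_slice, Function.update_eq_self, hzero]
    refine ih (Function.update w i β) (hup β hβ) (fun l hl => ?_) ?_
    · rcases eq_or_ne l i with rfl | hli
      · simp
      · simpa [hli] using h0 l (by simp [hl, hli])
    · rw [← eval_slice, hn, Polynomial.eval_zero]

end MvPolynomial

namespace MvPolynomial

/-- A polynomial of degree at most `k` in each variable, with real coefficients, without zeros on
the products of `upperHalfRay β`, all of whose logarithmic derivatives at `(β, …, β)` are at
least `-K`. -/
structure IsBarrierPoly {ι : Type*} (k : ℕ) (β K : ℝ) (P : MvPolynomial ι ℂ) : Prop where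
  mem_restrictDegree : P ∈ restrictDegree ι ℂ k
  map_conj : map (starRingEnd ℂ) P = P
  eval_ne_zero : ∀ w, (∀ i, w i ∈ upperHalfRay β) → eval w P ≠ 0
  barrier_le : ∀ j, (-(eval (fun _ => (β : ℂ)) (pderiv j P)) / eval (fun _ => (β : ℂ)) P).re ≤ K

variable {ι : Type*} [DecidableEq ι]

lemma eval_restrictZero_eq_eval_slice (w : ι → ℂ) (i : ι) (P : MvPolynomial ι ℂ) :
    eval w (restrictZero i P) = (slice w i P).eval 0 := by
  rw [eval_restrictZero, eval_slice]

lemma eval_shiftStep (w : ι → ℂ) (x : ℝ) (k : ℕ) (i : ι) (P : MvPolynomial ι ℂ) :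
    eval w (shiftStep x k i P) =
      x * (slice w i P).eval 0 + (k : ℂ)⁻¹ * (derivative (slice w i P)).eval 0 := by
  rw [derivative_slice, ← eval_restrictZero_eq_eval_slice, ← eval_restrictZero_eq_eval_slice]
  simp [shiftStep]

lemma eval_shiftStep_of_slice_eq {w : ι → ℂ} {i : ι} {P : MvPolynomial ι ℂ} {κ : Type*} [Fintype κ]
    {l : κ → ℂ} {c : ℂ}
    (hl : slice w i P = Polynomial.C c * ∏ j, (1 - Polynomial.C (l j) * Polynomial.X))
    (x : ℝ) (k : ℕ) :
    eval w (shiftStep x k i P) = (slice w i P).eval 0 * (x - (k : ℂ)⁻¹ * ∑ j, l j) := by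
  rw [eval_shiftStep, eval_derivative_zero_C_mul_prod hl]
  ring

namespace IsBarrierPoly

variable {k : ℕ} {β K : ℝ} {P : MvPolynomial ι ℂ}

lemma eval_restrictZero_ne_zero (h : IsBarrierPoly k β K P) (hβ : 0 < β) (i : ι) {w : ι → ℂ}
    (hw : ∀ j, w j ∈ upperHalfRay β) : eval w (restrictZero i P) ≠ 0 := by
  rw [eval_restrictZero]
  exact h.eval_ne_zero _
    (update_mem_upperHalfRay (fun l _ => hw l) (zero_mem_upperHalfRay hβ.le))

lemma im_shiftStep_div_nonpos (h : IsBarrierPoly k β K P) (hβ : 0 < β) (x : ℝ) (i : ι) {w : ι → ℂ}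
    (hw : ∀ j, w j ∈ upperHalfRay β) :
    (eval w (shiftStep x k i P) / eval w (restrictZero i P)).im ≤ 0 := by
  obtain ⟨l, hl, hl'⟩ := exists_slice_factorization hβ h.mem_restrictDegree h.eval_ne_zero
    (i := i) fun j _ => hw j
  rw [eval_shiftStep_of_slice_eq hl, ← eval_restrictZero_eq_eval_slice,
    mul_div_cancel_left₀ _ (h.eval_restrictZero_ne_zero hβ i hw)]
  have h1 : ((k : ℂ)⁻¹ * ∑ j, l j).im = (k : ℝ)⁻¹ * ∑ j, (l j).im := by
    rw [show (k : ℂ)⁻¹ = ((k : ℝ)⁻¹ : ℝ) by push_cast; rfl, Complex.im_ofReal_mul, Complex.im_sum]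
  rw [Complex.sub_im, h1, Complex.ofReal_im, zero_sub, neg_nonpos]
  exact mul_nonneg (by positivity) (Finset.sum_nonneg fun j _ => (hl' j).1)

lemma exists_slice_barrier (h : IsBarrierPoly k β K P) (hk : 2 ≤ k) (hβ : 0 < β) {x : ℝ}
    (hx : k - ((k : ℝ) - 1) ^ 2 / (k - 1 + β * K) ≤ k * β * x) (i : ι) :
    ∃ l : Fin k → ℝ, slice (fun _ => (β : ℂ)) i P =
        Polynomial.C ((slice (fun _ => (β : ℂ)) i P).eval 0) *
          ∏ j, (1 - Polynomial.C (l j : ℂ) * Polynomial.X) ∧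
      (∀ j, 0 ≤ l j ∧ l j * β < 1) ∧ ∀ j, 1 - l j * β ≤ β * ∑ j, (x - l j) := by
  obtain ⟨l, hl, hl'⟩ := exists_real_slice_factorization hβ h.mem_restrictDegree h.map_conj
    h.eval_ne_zero (w := fun _ => β) (fun _ => le_rfl) i
  refine ⟨l, hl, hl', one_sub_mul_le_mul_sum_sub hk hβ hl' ?_ hx⟩
  have h1 := h.barrier_le i
  have h2 := eval_derivative_C_mul_prod hl β
    fun j => by exact_mod_cast (sub_pos.2 (hl' j).2).ne'
  have h3 : Function.update (fun _ => (β : ℂ)) i β = fun _ => (β : ℂ) := Function.update_eq_self _ _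
  rw [derivative_slice, eval_slice, eval_slice, h3] at h2
  rw [h2, neg_neg, mul_div_cancel_left₀] at h1
  · refine le_trans (le_of_eq ?_) h1
    exact_mod_cast (Complex.ofReal_re (∑ j, l j / (1 - l j * β))).symm
  · exact h.eval_ne_zero _ fun _ => ofReal_mem_upperHalfRay.2 le_rfl

lemma sum_sub_pos (hk : 2 ≤ k) (hβ : 0 < β) {x : ℝ} {l : Fin k → ℝ} (hl : ∀ j, l j * β < 1)
    (hl' : ∀ j, 1 - l j * β ≤ β * ∑ j, (x - l j)) : 0 < ∑ j, (x - l j) := by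
  have h1 := hl' ⟨0, by omega⟩
  have h2 := hl ⟨0, by omega⟩
  exact pos_of_mul_pos_right (by linarith) hβ.le

lemma sub_inv_mul_sum_eq (hk : 2 ≤ k) (x : ℝ) (l : Fin k → ℝ) :
    (x : ℂ) - (k : ℂ)⁻¹ * ∑ j, (l j : ℂ) = (((k : ℝ)⁻¹ * ∑ j, (x - l j) : ℝ) : ℂ) := by
  have : (k : ℂ) ≠ 0 := by exact_mod_cast (by omega : k ≠ 0)
  push_cast
  rw [Finset.sum_sub_distrib]
  simp only [Finset.sum_const, Finset.card_univ, Fintype.card_fin, nsmul_eq_mul]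
  field_simp

lemma shiftStep_eval_ne_zero [Fintype ι] (h : IsBarrierPoly k β K P) (hk : 2 ≤ k) (hβ : 0 < β)
    {x : ℝ} (hx : k - ((k : ℝ) - 1) ^ 2 / (k - 1 + β * K) ≤ k * β * x) (i : ι) (w : ι → ℂ)
    (hw : ∀ j, w j ∈ upperHalfRay β) : eval w (shiftStep x k i P) ≠ 0 := by
  have hQne : ∀ w, (∀ j, w j ∈ upperHalfRay β) → eval w (restrictZero i P) ≠ 0 :=
    fun w hw => h.eval_restrictZero_ne_zero hβ i hw
  refine eval_ne_zero_of_im_div_nonpos hQne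
    (fun w hw => h.im_shiftStep_div_nonpos hβ x i hw) (fun b hb hzero => ?_) w hw
  have hmono := re_eval_div_le hβ (N := -shiftStep x k i P)
    (neg_mem (shiftStep_mem_restrictDegree h.mem_restrictDegree x k i))
    (restrictZero_mem_restrictDegree h.mem_restrictDegree i)
    (by rw [map_conj_restrictZero, h.map_conj]) hQne
    (fun w hw => by
      rw [map_neg, neg_div, Complex.neg_im]
      exact neg_nonneg.2 (h.im_shiftStep_div_nonpos hβ x i hw)) hb
  rw [map_neg, map_neg, hzero, neg_zero, zero_div, Complex.zero_re] at hmono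
  obtain ⟨l, hl, hl', hgap⟩ := h.exists_slice_barrier hk hβ hx i
  have hpos := sum_sub_pos hk hβ (fun j => (hl' j).2) hgap
  rw [eval_shiftStep_of_slice_eq hl, ← eval_restrictZero_eq_eval_slice, neg_div,
    mul_div_cancel_left₀ _ (hQne _ fun _ => ofReal_mem_upperHalfRay.2 le_rfl),
    sub_inv_mul_sum_eq hk, Complex.neg_re, Complex.ofReal_re] at hmono
  have : 0 < (k : ℝ)⁻¹ * ∑ j, (x - l j) := mul_pos (by positivity) hpos
  linarith

lemma im_neg_pderiv_div_nonneg (h : IsBarrierPoly k β K P) (hβ : 0 < β) {j : ι} {w : ι → ℂ}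
    (hw : ∀ i, w i ∈ upperHalfRay β) (hj : w j = β) :
    0 ≤ (-(eval w (pderiv j P)) / eval w P).im := by
  obtain ⟨r, hr, hr'⟩ := exists_slice_factorization hβ h.mem_restrictDegree h.eval_ne_zero
    (i := j) fun i _ => hw i
  have h1 := eval_derivative_C_mul_prod hr β fun i => one_sub_mul_ofReal_ne_zero hβ (hr' i)
  rw [derivative_slice, eval_slice, eval_slice, ← hj, Function.update_eq_self] at h1
  rw [h1, neg_neg, mul_div_cancel_left₀ _ (h.eval_ne_zero w hw), Complex.im_sum, hj]
  exact Finset.sum_nonneg fun i _ => im_div_one_sub_mul_nonneg (hr' i).1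

lemma shiftStep_barrier_le (h : IsBarrierPoly k β K P) (hk : 2 ≤ k) (hβ : 0 < β)
    {x : ℝ} (hx : k - ((k : ℝ) - 1) ^ 2 / (k - 1 + β * K) ≤ k * β * x) {i j : ι} (hij : i ≠ j) :
    (-(eval (fun _ => (β : ℂ)) (pderiv j (shiftStep x k i P))) /
      eval (fun _ => (β : ℂ)) (shiftStep x k i P)).re ≤ K := by
  obtain ⟨l, hl, hl', hgap⟩ := h.exists_slice_barrier hk hβ hx i
  have hpos := sum_sub_pos hk hβ (fun j => (hl' j).2) hgap
  have hβD : (β : ℂ) ∈ upperHalfRay β := ofReal_mem_upperHalfRay.2 le_rfl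
  have hc : (slice (fun _ => (β : ℂ)) i P).eval 0 ≠ 0 := by
    rw [← eval_restrictZero_eq_eval_slice]
    exact h.eval_restrictZero_ne_zero hβ i fun _ => hβD
  obtain ⟨a, W, hW, hrep, hder⟩ := exists_nevanlinna_rep hc hl
    (n := slice (fun _ => (β : ℂ)) i (-pderiv j P))
    (natDegree_slice_le (neg_mem (pderiv_mem_restrictDegree h.mem_restrictDegree j)) _ i)
    (fun w hw => by
      rw [eval_slice, eval_slice, map_neg]
      exact h.im_neg_pderiv_div_nonneg hβ
        (update_mem_upperHalfRay (fun _ _ => hβD) (Or.inl hw)) (by simp [hij.symm]))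
  have hcomm : pderiv j (shiftStep x k i P) = shiftStep x k i (pderiv j P) := by
    simp only [shiftStep, map_add, pderiv_mul, pderiv_C, zero_mul, zero_add,
      pderiv_restrictZero_of_ne hij, pderiv_comm i j]
  have h3 : Function.update (fun _ => (β : ℂ)) i β = fun _ => (β : ℂ) := Function.update_eq_self _ _
  have h0 := hrep 0 (by simp)
  simp only [zero_div, mul_zero, Finset.sum_const_zero, add_zero] at h0
  rw [div_eq_iff hc] at h0
  have hnum : -(eval (fun _ => (β : ℂ)) (pderiv j (shiftStep x k i P))) =
      a * eval (fun _ => (β : ℂ)) (shiftStep x k i P) +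
        (k : ℂ)⁻¹ * (∑ l, (W l : ℂ)) * (slice (fun _ => (β : ℂ)) i P).eval 0 := by
    rw [hcomm, ← map_neg, show -shiftStep x k i (pderiv j P) = shiftStep x k i (-pderiv j P) by
      simp only [shiftStep, map_neg]; ring, eval_shiftStep, h0, hder, eval_shiftStep]
    ring
  have hk0 : (k : ℂ)⁻¹ ≠ 0 := inv_ne_zero (by exact_mod_cast (by omega : k ≠ 0))
  have hS : ((∑ j, (x - l j) : ℝ) : ℂ) ≠ 0 := by exact_mod_cast hpos.ne'
  have hR := eval_shiftStep_of_slice_eq hl x k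
  rw [sub_inv_mul_sum_eq hk] at hR
  push_cast only [Complex.ofReal_mul, Complex.ofReal_inv, Complex.ofReal_natCast] at hR
  have hnew : -(eval (fun _ => (β : ℂ)) (pderiv j (shiftStep x k i P))) /
      eval (fun _ => (β : ℂ)) (shiftStep x k i P) =
      a + ((∑ m, W m / ∑ j, (x - l j) : ℝ) : ℂ) := by
    rw [hnum, hR, ← Finset.sum_div, Complex.ofReal_div, ← Complex.ofReal_sum]
    generalize ((∑ j, (x - l j) : ℝ) : ℂ) = S at hS
    field_simp
  have hold := hrep β fun m => by exact_mod_cast (sub_pos.2 (hl' m).2).ne'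
  rw [eval_slice, eval_slice, h3, map_neg] at hold
  refine le_trans ?_ (h.barrier_le j)
  rw [hnew, hold, Complex.add_re, Complex.add_re, Complex.ofReal_re]
  have hre : (∑ m, (W m : ℂ) * (β / (1 - l m * β))).re = ∑ m, W m * (β / (1 - l m * β)) := by
    exact_mod_cast Complex.ofReal_re (∑ m, W m * (β / (1 - l m * β)))
  rw [hre]
  refine add_le_add_right (Finset.sum_le_sum fun m _ => ?_) _
  rw [div_eq_mul_inv]
  refine mul_le_mul_of_nonneg_left ?_ (hW m)
  rw [← one_div, div_le_div_iff₀ hpos (sub_pos.2 (hl' m).2), one_mul]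
  exact hgap m

theorem shiftStep [Fintype ι] (h : IsBarrierPoly k β K P) (hk : 2 ≤ k) (hβ : 0 < β) (hK : 0 ≤ K)
    {x : ℝ} (hx : k - ((k : ℝ) - 1) ^ 2 / (k - 1 + β * K) ≤ k * β * x) (i : ι) :
    IsBarrierPoly k β K (shiftStep x k i P) where
  mem_restrictDegree := shiftStep_mem_restrictDegree h.mem_restrictDegree x k i
  map_conj := map_conj_shiftStep h.map_conj x k i
  eval_ne_zero := h.shiftStep_eval_ne_zero hk hβ hx i
  barrier_le j := by
    rcases eq_or_ne i j with rfl | hij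
    · have : pderiv i (MvPolynomial.shiftStep x k i P) = 0 := by
        simp only [MvPolynomial.shiftStep, map_add, pderiv_mul, pderiv_C, zero_mul, zero_add,
          pderiv_restrictZero_self, mul_zero]
      simpa [this] using hK
    · exact h.shiftStep_barrier_le hk hβ hx hij

end IsBarrierPoly

end MvPolynomial

lemma Derivation.map_finset_prod {R S κ : Type*} [CommSemiring R] [CommSemiring S] [Algebra R S]
    [DecidableEq κ] (D : Derivation R S S) (s : Finset κ) (f : κ → S) :
    D (∏ a ∈ s, f a) = ∑ c ∈ s, ∏ a ∈ s, if a = c then D (f a) else f a := by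
  induction s using Finset.induction_on with
  | empty => simp
  | insert b s hb ih =>
    have h1 : ∏ a ∈ s, (if a = b then D (f a) else f a) = ∏ a ∈ s, f a :=
      Finset.prod_congr rfl fun a ha => if_neg (by rintro rfl; exact hb ha)
    have h2 : ∀ c ∈ s, (if b = c then D (f b) else f b) = f b :=
      fun c hc => if_neg (by rintro rfl; exact hb hc)
    rw [Finset.prod_insert hb, Derivation.leibniz, ih, Finset.sum_insert hb,
      Finset.prod_insert hb, h1, if_pos rfl, smul_eq_mul, smul_eq_mul, Finset.mul_sum, add_comm,
      mul_comm]
    congr 1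
    refine Finset.sum_congr rfl fun c hc => ?_
    rw [Finset.prod_insert hb, h2 c hc]

lemma Derivation.map_det {R S n : Type*} [CommRing R] [CommRing S] [Algebra R S]
    [Fintype n] [DecidableEq n] (D : Derivation R S S) (M : Matrix n n S) :
    D M.det = ∑ c, (M.updateCol c fun a => D (M a c)).det := by
  simp only [Matrix.det_apply, map_sum]
  rw [Finset.sum_comm]
  refine Finset.sum_congr rfl fun σ _ => ?_
  rw [Units.smul_def, Derivation.map_smul_of_tower, Derivation.map_finset_prod, Finset.smul_sum]
  refine Finset.sum_congr rfl fun c _ => ?_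
  rw [Units.smul_def]
  congr 1
  refine Finset.prod_congr rfl fun a _ => ?_
  rw [Matrix.updateCol_apply]
  split_ifs with h
  · rw [h]
  · rfl

namespace Matrix

variable {n ι : Type*} [Fintype n] [DecidableEq n]

/-- The polynomial `det (1 - A Z)`, where `Z` is the diagonal matrix of variables `z_{π c}`. -/
noncomputable def detPoly (A : Matrix n n ℂ) (π : n → ι) : MvPolynomial ι ℂ :=
  (1 - A.map MvPolynomial.C * diagonal fun c => MvPolynomial.X (π c)).det

lemma eval_detPoly (A : Matrix n n ℂ) (π : n → ι) (w : ι → ℂ) :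
    MvPolynomial.eval w (detPoly A π) = (1 - A * diagonal fun c => w (π c)).det := by
  rw [detPoly, RingHom.map_det]
  congr 1
  ext a c
  simp [sub_apply, mul_diagonal, one_apply, apply_ite (MvPolynomial.eval w)]

lemma detPoly_mem_restrictDegree (A : Matrix n n ℂ) (π : n → ι) {k : ℕ} [DecidableEq ι]
    (hk : ∀ i, (Finset.univ.filter fun c => π c = i).card ≤ k) :
    detPoly A π ∈ MvPolynomial.restrictDegree ι ℂ k := by
  rw [MvPolynomial.mem_restrictDegree_iff_sup]
  intro i
  rw [← MvPolynomial.degreeOf_def, detPoly, det_apply]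
  refine (MvPolynomial.degreeOf_sum_le _ _ _).trans (Finset.sup_le fun σ _ => ?_)
  have hent : ∀ a c, MvPolynomial.degreeOf i
      ((1 - A.map MvPolynomial.C * diagonal fun c => MvPolynomial.X (π c) :
        Matrix n n (MvPolynomial ι ℂ)) a c) ≤ if π c = i then 1 else 0 := by
    intro a c
    rw [sub_apply, mul_diagonal, map_apply]
    refine (MvPolynomial.degreeOf_sub_le _ _ _).trans (max_le ?_ ?_)
    · rw [one_apply]
      split_ifs <;> simp
    · refine (MvPolynomial.degreeOf_C_mul_le _ _ _).trans ?_
      rw [MvPolynomial.degreeOf_X]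
      simp [eq_comm]
  have hprod : MvPolynomial.degreeOf i (∏ c,
      (1 - A.map MvPolynomial.C * diagonal fun c => MvPolynomial.X (π c) :
        Matrix n n (MvPolynomial ι ℂ)) (σ c) c) ≤ k := by
    refine (MvPolynomial.degreeOf_prod_le _ _ _).trans
      ((Finset.sum_le_sum fun c _ => hent (σ c) c).trans ?_)
    rw [← Finset.card_filter]
    exact hk i
  rcases Int.units_eq_one_or (Equiv.Perm.sign σ) with h | h
  · rwa [h, one_smul]
  · rwa [h, Units.neg_smul, one_smul, MvPolynomial.degreeOf_neg]

lemma map_conj_detPoly {A : Matrix n n ℂ} (hA : A.IsHermitian) (π : n → ι) :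
    MvPolynomial.map (starRingEnd ℂ) (detPoly A π) = detPoly A π := by
  rw [detPoly, RingHom.map_det, det_one_sub_mul_comm, ← det_transpose]
  congr 1
  refine Matrix.ext fun a c => ?_
  change MvPolynomial.map (starRingEnd ℂ)
    ((1 - A.map MvPolynomial.C * diagonal fun c => MvPolynomial.X (π c) :
    Matrix n n (MvPolynomial ι ℂ)) c a) = _
  rw [sub_apply, mul_diagonal, map_apply, sub_apply, diagonal_mul, map_apply, map_sub, map_mul,
    MvPolynomial.map_C, MvPolynomial.map_X, show starRingEnd ℂ (A c a) = A a c from hA.apply a c,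
    mul_comm, one_apply, one_apply]
  congr 1
  simp only [apply_ite (MvPolynomial.map (starRingEnd ℂ)), map_one, map_zero, eq_comm]

lemma PosSemidef.sub_mul_self {A : Matrix n n ℂ} (hA : A.PosSemidef) (hAI : (1 - A).PosSemidef) :
    (A - A * A).PosSemidef := by
  have h1 := hAI.conjTranspose_mul_mul_same A
  have h2 := hA.conjTranspose_mul_mul_same (1 - A)
  rw [hA.1.eq] at h1
  rw [hAI.1.eq] at h2
  convert h1.add h2 using 1
  noncomm_ring

lemma PosSemidef.sub_mul_self_mul {A : Matrix n n ℂ} (hA : A.PosSemidef)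
    (hAI : (1 - A).PosSemidef) {β : ℝ} (hβ : 0 ≤ β) (hβ1 : β ≤ 1) :
    ((A - A * A) * (1 - (β : ℂ) • A)).PosSemidef := by
  have h1 := (hA.sub_mul_self hAI).smul (a := ((1 - β : ℝ) : ℂ))
    (by exact_mod_cast sub_nonneg.2 hβ1)
  have h2 := (hA.conjTranspose_mul_mul_same (1 - A)).smul (a := (β : ℂ)) (by exact_mod_cast hβ)
  rw [hAI.1.eq] at h2
  convert h1.add h2 using 1
  push_cast
  simp only [mul_sub, sub_mul, mul_one, one_mul, smul_sub, sub_smul, one_smul, mul_assoc,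
    Algebra.mul_smul_comm]
  abel

lemma det_one_sub_mul_diagonal_ne_zero {A : Matrix n n ℂ} (hA : A.PosSemidef)
    (hAI : (1 - A).PosSemidef) {β : ℝ} (hβ : β < 1) {w : n → ℂ}
    (hw : ∀ c, w c ∈ upperHalfRay β) : (1 - A * diagonal w).det ≠ 0 := by
  intro hdet
  obtain ⟨v, hv0, hv⟩ := exists_mulVec_eq_zero_iff.2 hdet
  rw [sub_mulVec, one_mulVec, sub_eq_zero, ← mulVec_mulVec] at hv
  set u := diagonal w *ᵥ v with hu
  have h1 := (hA.sub_mul_self hAI).dotProduct_mulVec_nonneg u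
  have h2 := hA.dotProduct_mulVec_nonneg u
  have hstar : star u ⬝ᵥ ((A * A) *ᵥ u) = star v ⬝ᵥ v := by
    rw [← mulVec_mulVec, ← hv, dotProduct_mulVec]
    conv_rhs => rw [hv, star_mulVec, hA.1.eq, ← hv]
  have hvu : star u ⬝ᵥ (A *ᵥ u) = star v ⬝ᵥ u := by
    rw [dotProduct_mulVec]
    conv_rhs => rw [hv, star_mulVec, hA.1.eq]
  have hvu' : star v ⬝ᵥ u = ∑ c, w c * (Complex.normSq (v c) : ℂ) := by
    refine Finset.sum_congr rfl fun c _ => ?_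
    rw [hu, mulVec_diagonal, Pi.star_apply, Complex.normSq_eq_conj_mul_self, ← starRingEnd_apply]
    ring
  have hvv : star v ⬝ᵥ v = ∑ c, (Complex.normSq (v c) : ℂ) :=
    Finset.sum_congr rfl fun c _ => (Complex.normSq_eq_conj_mul_self (z := v c)).symm
  rw [sub_mulVec, dotProduct_sub, hstar, hvu, hvu', hvv, Complex.nonneg_iff] at h1
  rw [hvu, hvu', Complex.nonneg_iff] at h2
  have him : ∑ c, (w c).im * Complex.normSq (v c) = 0 := by
    rw [h2.2, Complex.im_sum]
    exact Finset.sum_congr rfl fun c _ => (Complex.im_mul_ofReal _ _).symm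
  have hre : 0 ≤ ∑ c, ((w c).re - 1) * Complex.normSq (v c) := by
    refine h1.1.trans_eq ?_
    rw [Complex.sub_re, Complex.re_sum, Complex.re_sum, ← Finset.sum_sub_distrib]
    exact Finset.sum_congr rfl fun c _ => by rw [Complex.re_mul_ofReal, Complex.ofReal_re]; ring
  have hw0 : ∀ c, 0 ≤ (w c).im := fun c => (hw c).elim le_of_lt fun h => h.1.ge
  have hz := (Finset.sum_eq_zero_iff_of_nonneg
    fun c _ => mul_nonneg (hw0 c) (Complex.normSq_nonneg _)).1 him
  obtain ⟨c, hc⟩ := Function.ne_iff.1 hv0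
  have hle : ∀ c, ((w c).re - 1) * Complex.normSq (v c) ≤ (β - 1) * Complex.normSq (v c) := by
    intro c
    rcases mul_eq_zero.1 (hz c (Finset.mem_univ c)) with h | h
    · have := (hw c).resolve_left (by rw [h]; exact lt_irrefl 0)
      exact mul_le_mul_of_nonneg_right (sub_le_sub_right this.2 1) (Complex.normSq_nonneg _)
    · rw [h, mul_zero, mul_zero]
  have hpos : 0 < ∑ c, Complex.normSq (v c) :=
    Finset.sum_pos' (fun c _ => Complex.normSq_nonneg _)
      ⟨c, Finset.mem_univ c, Complex.normSq_pos.2 hc⟩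
  have := hre.trans (Finset.sum_le_sum fun c _ => hle c)
  rw [← Finset.mul_sum] at this
  nlinarith

lemma re_inv_mul_apply_le {A : Matrix n n ℂ} (hA : A.PosSemidef) (hAI : (1 - A).PosSemidef)
    {β : ℝ} (hβ : 0 ≤ β) (hβ1 : β < 1) (hdet : IsUnit (1 - (β : ℂ) • A).det) (c : n) :
    (((1 - (β : ℂ) • A)⁻¹ * A) c c).re ≤ (A c c).re / (1 - β) := by
  set B := 1 - (β : ℂ) • A with hB
  have hBh : B.IsHermitian := by
    refine isHermitian_one.sub ?_
    rw [IsHermitian, conjTranspose_smul, hA.1.eq, Complex.star_def, Complex.conj_ofReal]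
  have h := ((hA.sub_mul_self_mul hAI hβ hβ1.le).conjTranspose_mul_mul_same B⁻¹).smul
    (a := (β : ℂ)) (by exact_mod_cast hβ)
  rw [conjTranspose_nonsing_inv, hBh.eq, ← hB] at h
  have heq : (β : ℂ) • (B⁻¹ * ((A - A * A) * B) * B⁻¹) = A - (1 - β : ℂ) • (B⁻¹ * A) := by
    have hAB : (β : ℂ) • (A - A * A) = B * A - (1 - β : ℂ) • A := by
      rw [hB]
      simp only [sub_mul, one_mul, smul_sub, sub_smul, one_smul, smul_mul_assoc]
      abel
    rw [mul_assoc, mul_assoc, mul_nonsing_inv B hdet, mul_one, ← Algebra.mul_smul_comm, hAB,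
      mul_sub, ← mul_assoc, nonsing_inv_mul B hdet, one_mul, Algebra.mul_smul_comm]
  rw [heq] at h
  have h2 := (Complex.nonneg_iff.1 (h.diag_nonneg (i := c))).1
  rw [sub_apply, smul_apply, smul_eq_mul, Complex.sub_re,
    show (1 - β : ℂ) = ((1 - β : ℝ) : ℂ) by push_cast; rfl, Complex.re_ofReal_mul] at h2
  rw [le_div_iff₀ (by linarith)]
  linarith

lemma neg_eval_pderiv_detPoly_div [DecidableEq ι] (A : Matrix n n ℂ) (π : n → ι) (β : ℂ)
    (j : ι) :
    -(MvPolynomial.eval (fun _ => β) (MvPolynomial.pderiv j (detPoly A π))) /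
      MvPolynomial.eval (fun _ => β) (detPoly A π) =
      ∑ c with π c = j, ((1 - β • A)⁻¹ * A) c c := by
  set B := 1 - β • A with hB
  have hBd : 1 - A * diagonal (fun _ => β) = B := by
    rw [hB, ← smul_one_eq_diagonal, Algebra.mul_smul_comm, mul_one]
  have hcol : ∀ c, MvPolynomial.eval (fun _ => β) (((1 - A.map MvPolynomial.C *
      diagonal fun c => MvPolynomial.X (π c) : Matrix n n (MvPolynomial ι ℂ)).updateCol c fun a =>
        MvPolynomial.pderiv j ((1 - A.map MvPolynomial.C *
          diagonal fun c => MvPolynomial.X (π c) : Matrix n n (MvPolynomial ι ℂ)) a c)).det) =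
      if π c = j then -(B.adjugate * A) c c else 0 := by
    intro c
    have h1 : (if π c = j then -(B.adjugate * A) c c else 0) =
        (B.updateCol c fun a => if π c = j then -(A a c) else 0).det := by
      rw [← cramer_apply, cramer_eq_adjugate_mulVec]
      simp only [mulVec, dotProduct, mul_apply]
      split_ifs <;> simp
    rw [h1, RingHom.map_det, ← hBd]
    congr 1
    ext a b
    change MvPolynomial.eval _ (updateCol _ _ _ a b) = _
    rw [updateCol_apply, updateCol_apply]
    split_ifs with h2 h3
    · simp [sub_apply, mul_diagonal, one_apply, apply_ite (MvPolynomial.pderiv j), h3]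
    · simp [sub_apply, mul_diagonal, one_apply, apply_ite (MvPolynomial.pderiv j),
        MvPolynomial.pderiv_X_of_ne h3]
    · simp [sub_apply, mul_diagonal, one_apply, apply_ite (MvPolynomial.eval _)]
  rw [eval_detPoly, hBd, detPoly, Derivation.map_det, map_sum]
  simp only [hcol]
  rw [← Finset.sum_filter, Finset.sum_neg_distrib, neg_neg, Finset.sum_div]
  refine Finset.sum_congr rfl fun c _ => ?_
  rw [inv_def, Ring.inverse_eq_inv', smul_mul_assoc, smul_apply, smul_eq_mul, div_eq_inv_mul]

lemma isBarrierPoly_detPoly [DecidableEq ι] {A : Matrix n n ℂ} (hA : A.PosSemidef)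
    (hAI : (1 - A).PosSemidef) (π : n → ι) {k : ℕ}
    (hk : ∀ i, (Finset.univ.filter fun c => π c = i).card ≤ k) {ε β : ℝ}
    (hε : ∀ i, ∑ c with π c = i, (A c c).re ≤ ε) (hβ : 0 ≤ β) (hβ1 : β < 1) :
    MvPolynomial.IsBarrierPoly k β (ε / (1 - β)) (detPoly A π) where
  mem_restrictDegree := detPoly_mem_restrictDegree A π hk
  map_conj := map_conj_detPoly hA.1 π
  eval_ne_zero w hw := by
    rw [eval_detPoly]
    exact det_one_sub_mul_diagonal_ne_zero hA hAI hβ1 fun c => hw (π c)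
  barrier_le j := by
    have hdet : IsUnit (1 - (β : ℂ) • A).det := by
      have := det_one_sub_mul_diagonal_ne_zero hA hAI hβ1 (w := fun _ => (β : ℂ))
        fun _ => ofReal_mem_upperHalfRay.2 le_rfl
      rwa [← smul_one_eq_diagonal, Algebra.mul_smul_comm, mul_one, ← isUnit_iff_ne_zero] at this
    rw [neg_eval_pderiv_detPoly_div A π β, Complex.re_sum]
    refine (Finset.sum_le_sum fun c _ => re_inv_mul_apply_le hA hAI hβ hβ1 hdet c).trans ?_
    rw [← Finset.sum_div]
    exact div_le_div_of_nonneg_right (hε j) (by linarith)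

end Matrix

lemma Fintype.sum_sum_update {ι κ M : Type*} [Fintype ι] [DecidableEq ι] [Fintype κ]
    [DecidableEq κ] [AddCommMonoid M] (i : ι) (F : (ι → κ) → M) :
    ∑ g : ι → κ, ∑ j, F (Function.update g i j) = Fintype.card κ • ∑ g, F g := by
  have hinv : Function.Involutive
      fun q : (ι → κ) × κ => (Function.update q.1 i q.2, q.1 i) := fun q => by simp
  have h := Equiv.sum_comp hinv.toPerm fun q : (ι → κ) × κ => F q.1
  rw [Fintype.sum_prod_type, Fintype.sum_prod_type] at h
  simp only [Function.Involutive.coe_toPerm, Finset.sum_const, Finset.card_univ] at h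
  rw [h, Finset.smul_sum]

namespace Matrix

variable {ι κ : Type*} [DecidableEq ι] [DecidableEq κ]

/-- The matrix whose columns in the blocks outside `s` are those of `1 - A Z`, and whose columns in
the blocks of `s` are those of `x - A` for the indices selected by `g` and those of the identity
for the others. -/
noncomputable def mixedMatrix (A : Matrix (κ × ι) (κ × ι) ℂ) (x : ℝ) (s : Finset ι) (g : ι → κ) :
    Matrix (κ × ι) (κ × ι) (MvPolynomial ι ℂ) :=
  of fun a c =>
    if c.2 ∈ s then
      if g c.2 = c.1 then
        MvPolynomial.C (x : ℂ) * (1 : Matrix (κ × ι) (κ × ι) (MvPolynomial ι ℂ)) a c -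
          MvPolynomial.C (A a c)
      else (1 : Matrix (κ × ι) (κ × ι) (MvPolynomial ι ℂ)) a c
    else (1 : Matrix (κ × ι) (κ × ι) (MvPolynomial ι ℂ)) a c -
      MvPolynomial.C (A a c) * MvPolynomial.X c.2

variable (A : Matrix (κ × ι) (κ × ι) ℂ) (x : ℝ) {s : Finset ι} {i : ι}

lemma mixedMatrix_insert_update (hi : i ∉ s) (g : ι → κ) (j : κ) :
    mixedMatrix A x (insert i s) (Function.update g i j) =
      ((mixedMatrix A x s g).map (MvPolynomial.restrictZero i)).updateCol (j, i)
        ((MvPolynomial.C (x : ℂ) : MvPolynomial ι ℂ) •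
          (fun a => (1 : Matrix (κ × ι) (κ × ι) (MvPolynomial ι ℂ)) a (j, i)) +
          fun a => -MvPolynomial.C (A a (j, i))) := by
  refine Matrix.ext fun a ⟨j', l⟩ => ?_
  rw [updateCol_apply, map_apply]
  rcases eq_or_ne l i with rfl | hl
  · rcases eq_or_ne j' j with rfl | hj
    · simp [mixedMatrix, sub_eq_add_neg]
    · simp [mixedMatrix, hi, hj, hj.symm, one_apply, MvPolynomial.restrictZero]
  · by_cases hs : l ∈ s
    · simp only [mixedMatrix, of_apply, Finset.mem_insert, hl, hs, one_apply, Prod.mk.injEq,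
        and_false, if_true, or_true, if_false, Function.update_of_ne hl]
      split_ifs <;> simp [MvPolynomial.restrictZero]
    · simp [mixedMatrix, hl, hs, one_apply, MvPolynomial.restrictZero]

lemma map_restrictZero_mixedMatrix_eq_updateCol (hi : i ∉ s) (g : ι → κ) (j : κ) :
    (mixedMatrix A x s g).map (MvPolynomial.restrictZero i) =
      ((mixedMatrix A x s g).map (MvPolynomial.restrictZero i)).updateCol (j, i)
        fun a => (1 : Matrix (κ × ι) (κ × ι) (MvPolynomial ι ℂ)) a (j, i) := by
  rw [eq_comm]
  convert! updateCol_eq_self _ (j, i) using 2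
  ext1 a
  simp [mixedMatrix, hi, one_apply, MvPolynomial.restrictZero]

variable [Fintype ι] [Fintype κ]

/-- The average over `g` of the determinants of the matrices `mixedMatrix A x s g`. -/
noncomputable def mixedPoly (s : Finset ι) :
    MvPolynomial ι ℂ :=
  MvPolynomial.C (((Fintype.card κ : ℂ) ^ Fintype.card ι)⁻¹) *
    ∑ g : ι → κ, (mixedMatrix A x s g).det

lemma mixedPoly_empty [Nonempty κ] :
    mixedPoly A x ∅ = detPoly A Prod.snd := by
  have h : ∀ g : ι → κ, (mixedMatrix A x ∅ g).det = detPoly A Prod.snd := by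
    intro g
    rw [detPoly]
    congr 1
    refine Matrix.ext fun a c => ?_
    simp [mixedMatrix, mul_diagonal]
  simp only [mixedPoly, h, Finset.sum_const, Finset.card_univ, Fintype.card_fun, nsmul_eq_mul]
  rw [← mul_assoc, ← map_natCast (MvPolynomial.C (σ := ι) (R := ℂ)), ← map_mul, Nat.cast_pow,
    inv_mul_cancel₀ (by simp), map_one, one_mul]

lemma restrictZero_pderiv_det_mixedMatrix (hi : i ∉ s) (g : ι → κ) :
    MvPolynomial.restrictZero i (MvPolynomial.pderiv i (mixedMatrix A x s g).det) =
      ∑ j, (((mixedMatrix A x s g).map (MvPolynomial.restrictZero i)).updateCol (j, i)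
        fun a => -MvPolynomial.C (A a (j, i))).det := by
  rw [Derivation.map_det, map_sum, Fintype.sum_prod_type]
  refine Finset.sum_congr rfl fun j _ => ?_
  rw [Finset.sum_eq_single i]
  · rw [AlgHom.map_det]
    congr 1
    refine Matrix.ext fun a c => ?_
    change MvPolynomial.restrictZero i (updateCol _ _ _ a c) = _
    rw [updateCol_apply, updateCol_apply]
    split_ifs with h
    · simp [mixedMatrix, hi, one_apply, apply_ite (MvPolynomial.pderiv i),
        MvPolynomial.restrictZero]
    · rfl
  · intro l _ hl
    rw [det_eq_zero_of_column_eq_zero (j, l), map_zero]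
    intro a
    rw [updateCol_self]
    simp only [mixedMatrix, of_apply, one_apply]
    split_ifs <;> simp [MvPolynomial.pderiv_X_of_ne hl]
  · simp

lemma shiftStep_det_mixedMatrix [Nonempty κ] (hi : i ∉ s) (g : ι → κ) :
    MvPolynomial.shiftStep x (Fintype.card κ) i (mixedMatrix A x s g).det =
      MvPolynomial.C ((Fintype.card κ : ℂ)⁻¹) *
        ∑ j, (mixedMatrix A x (insert i s) (Function.update g i j)).det := by
  have hcard : (Fintype.card κ : ℂ) ≠ 0 := by simp
  simp only [MvPolynomial.shiftStep, mixedMatrix_insert_update A x hi, det_updateCol_add,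
    det_updateCol_smul, ← map_restrictZero_mixedMatrix_eq_updateCol A x hi, Finset.sum_add_distrib,
    Finset.sum_const, Finset.card_univ, nsmul_eq_mul, restrictZero_pderiv_det_mixedMatrix A x hi,
    mul_add]
  congr 1
  rw [← map_natCast (MvPolynomial.C (σ := ι) (R := ℂ)), ← mul_assoc, ← map_mul,
    inv_mul_cancel₀ hcard, map_one, one_mul, AlgHom.map_det]
  rfl

lemma shiftStep_mixedPoly [Nonempty κ] (hi : i ∉ s) :
    MvPolynomial.shiftStep x (Fintype.card κ) i (mixedPoly A x s) = mixedPoly A x (insert i s) := by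
  have hcard : (Fintype.card κ : ℂ) ≠ 0 := by simp
  rw [mixedPoly, MvPolynomial.shiftStep_C_mul, MvPolynomial.shiftStep_sum, mixedPoly]
  simp only [shiftStep_det_mixedMatrix A x hi]
  rw [← Finset.mul_sum, Fintype.sum_sum_update i fun g => (mixedMatrix A x (insert i s) g).det,
    nsmul_eq_mul, ← map_natCast (MvPolynomial.C (σ := ι) (R := ℂ)),
    ← mul_assoc (MvPolynomial.C (Fintype.card κ : ℂ)⁻¹), ← map_mul, inv_mul_cancel₀ hcard,
    map_one, one_mul]

lemma eval_det_mixedMatrix_univ (g : ι → κ) (w : ι → ℂ) :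
    MvPolynomial.eval w (mixedMatrix A x Finset.univ g).det =
      (A.submatrix (fun i => (g i, i)) fun i => (g i, i)).charpoly.eval (x : ℂ) := by
  have hM : (MvPolynomial.eval w).mapMatrix (mixedMatrix A x Finset.univ g) =
      of fun a c => if g c.2 = c.1 then x * (1 : Matrix (κ × ι) (κ × ι) ℂ) a c - A a c
        else (1 : Matrix (κ × ι) (κ × ι) ℂ) a c := by
    refine Matrix.ext fun a c => ?_
    simp only [mixedMatrix, RingHom.mapMatrix_apply, map_apply, of_apply, Finset.mem_univ, if_true,
      one_apply]
    split_ifs <;> simp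
  let e : ι ≃ {c : κ × ι // g c.2 = c.1} :=
    { toFun := fun i => ⟨(g i, i), rfl⟩
      invFun := fun c => c.1.2
      left_inv := fun i => rfl
      right_inv := fun c => Subtype.ext (Prod.ext c.2 rfl) }
  rw [RingHom.map_det, hM, twoBlockTriangular_det' _ (fun c : κ × ι => g c.2 = c.1),
    eval_charpoly]
  · rw [show toSquareBlockProp _ (fun c : κ × ι => ¬ g c.2 = c.1) = 1 from ?_, det_one, mul_one,
      ← det_submatrix_equiv_self e]
    · congr 1
      refine Matrix.ext fun i j => ?_
      by_cases h : i = j <;> simp [e, toSquareBlockProp, one_apply, h]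
    · refine Matrix.ext fun a c => ?_
      simp [toSquareBlockProp, c.2, one_apply, Subtype.ext_iff]
  · intro a ha c hc
    have : a ≠ c := by
      rintro rfl
      exact hc ha
    simp [hc, this]

end Matrix

lemma Matrix.isBarrierPoly_mixedPoly {ι κ : Type*} [Fintype ι] [DecidableEq ι] [Fintype κ]
    [DecidableEq κ] {A : Matrix (κ × ι) (κ × ι) ℂ} (hA : A.PosSemidef) (hAI : (1 - A).PosSemidef)
    (hκ : 2 ≤ Fintype.card κ) {ε β x : ℝ} (hε0 : 0 ≤ ε)
    (hε : ∀ i, ∑ j, (A (j, i) (j, i)).re ≤ ε) (hβ : 0 < β) (hβ1 : β < 1)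
    (hx : Fintype.card κ - ((Fintype.card κ : ℝ) - 1) ^ 2 /
      (Fintype.card κ - 1 + β * (ε / (1 - β))) ≤ Fintype.card κ * β * x) (s : Finset ι) :
    MvPolynomial.IsBarrierPoly (Fintype.card κ) β (ε / (1 - β)) (mixedPoly A x s) := by
  have : Nonempty κ := Fintype.card_pos_iff.mp (by omega)
  have hfib (i : ι) : (Finset.univ.filter fun c : κ × ι => c.2 = i) =
      Finset.univ.map ⟨fun j : κ => (j, i), Prod.mk_left_injective i⟩ := by
    ext ⟨j, l⟩
    simp [eq_comm]
  induction s using Finset.induction_on with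
  | empty =>
    rw [mixedPoly_empty]
    refine isBarrierPoly_detPoly hA hAI Prod.snd (fun i => ?_) (fun i => ?_) hβ.le hβ1
    · rw [hfib, Finset.card_map, Finset.card_univ]
    · rw [hfib, Finset.sum_map]
      exact hε i
  | insert i s hi ih =>
    rw [← shiftStep_mixedPoly A x hi]
    exact ih.shiftStep hκ hβ (div_nonneg hε0 (sub_nonneg.mpr hβ1.le)) hx i

lemma exists_barrier_point {k ε x : ℝ} (hk : 1 < k) (hε0 : 0 ≤ ε) (hεk : ε ≤ (k - 1) ^ 2 / k)
    (hx : 1 / k * (√(1 - ε / (k - 1)) + √ε) ^ 2 < x) :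
    ∃ β, 0 < β ∧ β < 1 ∧
      k - (k - 1) ^ 2 / (k - 1 + β * (ε / (1 - β))) ≤ k * β * x := by
  have hk0 : 0 < k := by linarith
  have hk1 : 0 < k - 1 := by linarith
  obtain ⟨a, rfl⟩ : ∃ a, ε = a * (k - 1) := ⟨ε / (k - 1), by field_simp⟩
  rw [mul_div_cancel_right₀ _ hk1.ne'] at hx
  have ha0 : 0 ≤ a := nonneg_of_mul_nonneg_left hε0 hk1
  have hak : k * a ≤ k - 1 := by
    rw [le_div_iff₀ hk0] at hεk
    nlinarith
  have ha1 : a < 1 := by nlinarith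
  set v := √(1 - a) * √(a * (k - 1)) with hv
  have hv2 : v ^ 2 = (1 - a) * (a * (k - 1)) := by
    rw [hv, mul_pow, Real.sq_sqrt (by linarith), Real.sq_sqrt hε0]
  have hv0 : 0 ≤ v := by positivity
  have hav : a ≤ v := by
    refine abs_le_of_sq_le_sq' ?_ hv0 |>.2
    nlinarith
  have hx' : 1 - a + a * (k - 1) + 2 * v < k * x := by
    rw [one_div_mul_eq_div, div_lt_iff₀ hk0, add_sq, Real.sq_sqrt (by linarith),
      Real.sq_sqrt hε0] at hx
    linarith
  obtain ⟨u, hu⟩ : ∃ u, k * x = 1 - a + a * (k - 1) + v + u :=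
    ⟨k * x - (1 - a + a * (k - 1) + v), by ring⟩
  have huv : v < u := by linarith
  have hua : 0 < u - a := by linarith
  have hu0 : 0 < u := by linarith
  have ht : 0 < 1 - a + u := by linarith
  refine ⟨1 / (1 - a + u), by positivity, by rw [div_lt_one ht]; linarith, ?_⟩
  have h1 : 1 - 1 / (1 - a + u) = (u - a) / (1 - a + u) := by
    field_simp
    ring
  have h2 : k - 1 + 1 / (1 - a + u) * (a * (k - 1) / ((u - a) / (1 - a + u))) =
      (k - 1) * u / (u - a) := by
    field_simp
    ring
  have h3 : k - (k - 1) ^ 2 / ((k - 1) * u / (u - a)) = (u + a * (k - 1)) / u := by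
    field_simp
    ring
  rw [h1, h2, h3, mul_right_comm, hu, mul_one_div, div_le_div_iff₀ hu0 ht]
  nlinarith

/-- If `0 ⪯ A ⪯ I_{km}`, `Σ_j A(i+(j−1)m,i+(j−1)m) ≤ ε` for all `i`, and
`ε ≤ (k−1)²/k`, then
`maxroot ψ_{k,m}[A] ≤ (1/k)·(√(1 − ε/(k−1)) + √ε)²`. -/
theorem maxRoot_psiCharPoly_le (k m : ℕ) (hk : 2 ≤ k) (hm : 1 ≤ m)
    (A : Matrix (Fin k × Fin m) (Fin k × Fin m) ℂ)
    (hA : A.PosSemidef) (hAI : (1 - A).PosSemidef)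
    (ε : ℝ) (hε : ∀ i : Fin m, ∑ j : Fin k, (A (j, i) (j, i)).re ≤ ε)
    (hεk : ε ≤ ((k : ℝ) - 1) ^ 2 / k) :
    maxRoot (psiCharPoly k m A)
      ≤ (1 / (k : ℝ)) * (Real.sqrt (1 - ε / ((k : ℝ) - 1)) + Real.sqrt ε) ^ 2 := by
  have hε0 : 0 ≤ ε := (Finset.sum_nonneg fun j _ =>
    (Complex.le_def.mp (hA.diag_nonneg (i := (j, ⟨0, hm⟩)))).1).trans (hε ⟨0, hm⟩)
  refine Real.sSup_le (fun x hx => ?_) (by positivity)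
  by_contra! hlt
  obtain ⟨β, hβ, hβ1, hβx⟩ := exists_barrier_point (by exact_mod_cast hk) hε0 hεk hlt
  have h := Matrix.isBarrierPoly_mixedPoly hA hAI (by simpa using hk) hε0 hε hβ hβ1
    (by simpa using hβx) Finset.univ
  refine h.eval_ne_zero (fun _ => (β : ℂ)) (fun _ => ofReal_mem_upperHalfRay.mpr le_rfl) ?_
  simpa [Matrix.mixedPoly, Matrix.eval_det_mixedMatrix_univ, psiCharPoly, eval_finsetSum]
    using hx
end
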